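/- Let V be a MOSVA and W a V-bimodule, both satisfying the pole-order condition. Let v_1, v_2 ∈ V and let f ∈ W̃_{z_3,…,z_{n+2}} be such that the series Y_W^L(v_1,z_1)Y_W^L(v_2,z_2)f(z_3,…,z_{n+2}) converges absolutely to a \overline{W}-valued rational function whenever |z_1| > |z_2| > |z_i| (i = 3,…,n+2). Then Y_W^L(v_1,z_1)Y_W^L(v_2,z_2)f(z_3,…,z_{n+2}) = Y_W^L(Y_V(v_1,z_1−z_2)v_2,z_2)f(z_3,…,z_{n+2}) for every (z_1,…,z_{n+2}) ∈ F_{n+2}ℂ with |z_1| > |z_2| > |z_1−z_2| + |z_i| (i = 3,…,n+2), and moreover E(Y_W^L(v_1,z_1)Y_W^L(v_2,z_2)f(z_3,…,z_{n+2})) = E(Y_W^L(Y_V(v_1,z_1−z_2)v_2,z_2)f(z_3,…,z_{n+2})) as elements of W̃_{z_1,…,z_{n+2}}. -/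

import Mathlib

set_option autoImplicit false
set_option maxHeartbeats 1000000

open scoped BigOperators

noncomputable section

namespace VA

/-- Absolute convergence of a series of complex numbers indexed by `ι` to the sum `s`. -/
def AbsConvTo {ι : Type*} (f : ι → ℂ) (s : ℂ) : Prop :=
  Summable (fun i => ‖f i‖) ∧ HasSum f s

/-- The configuration-space condition: the entries of `z` are pairwise distinct. -/
def Conf {ι : Type*} (z : ι → ℂ) : Prop := ∀ i j : ι, i ≠ j → z i ≠ z j

/-- `‖z 0‖ > ‖z 1‖ > ⋯ > ‖z (n-1)‖`. -/
def Ordered {n : ℕ} (z : Fin n → ℂ) : Prop := ∀ i j : Fin n, i < j → ‖z j‖ < ‖z i‖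

/-- `‖z 0‖ > ‖z 1‖ > ⋯ > ‖z (n-1)‖ > 0`. -/
def OrderedPos {n : ℕ} (z : Fin n → ℂ) : Prop := Ordered z ∧ ∀ i, 0 < ‖z i‖

/-- A rational function in the variables `z i`, `i : ι`, whose only possible poles are
at `z i = 0` and on the diagonals `z i = z j` (`i ≠ j`); it is recorded as a numerator
polynomial together with the orders of the poles. -/
structure RatFn (ι : Type*) [Fintype ι] [DecidableEq ι] where
  num : MvPolynomial ι ℂ
  a : ι → ℕ
  b : ι → ι → ℕ

def RatFn.eval {ι : Type*} [Fintype ι] [DecidableEq ι] (R : RatFn ι) (z : ι → ℂ) : ℂ :=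
  MvPolynomial.eval z R.num /
    ((∏ i, z i ^ R.a i) * ∏ q ∈ Finset.univ.offDiag, (z q.1 - z q.2) ^ R.b q.1 q.2)

/-- A rational function in the variables `z i`, `i : ι`, whose only possible poles are
on the diagonals `z i = z j` (`i ≠ j`). -/
structure DiagRatFn (ι : Type*) [Fintype ι] [DecidableEq ι] where
  num : MvPolynomial ι ℂ
  b : ι → ι → ℕ

def DiagRatFn.eval {ι : Type*} [Fintype ι] [DecidableEq ι] (R : DiagRatFn ι) (z : ι → ℂ) : ℂ :=
  MvPolynomial.eval z R.num / ∏ q ∈ Finset.univ.offDiag, (z q.1 - z q.2) ^ R.b q.1 q.2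

/-- A linear functional belongs to the graded dual iff its restriction to all but
finitely many homogeneous components vanishes. -/
def InGradedDual {ι : Type*} {M : Type*} [AddCommGroup M] [Module ℂ M]
    (proj : ι → M →ₗ[ℂ] M) (φ : M →ₗ[ℂ] ℂ) : Prop :=
  (Function.support fun i => φ ∘ₗ proj i).Finite

/-- Iterated application: `compApply n f w = f 0 (f 1 (⋯ (f (n-1) w)))`. -/
def compApply {M : Type*} : (n : ℕ) → (Fin n → (M → M)) → M → M
  | 0, _, w => w
  | n+1, f, w => f 0 (compApply n (fun i => f i.succ) w)

section Graded

variable (W : Type*) [AddCommGroup W] [Module ℂ W]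

/-- A `ℂ`-grading of `W`, recorded via the projections onto the homogeneous
subspaces, whose weights have lower-bounded real parts. -/
structure CGrading where
  proj : ℂ → W →ₗ[ℂ] W
  proj_comp : ∀ m n : ℂ, proj m ∘ₗ proj n = if m = n then proj n else 0
  proj_finite : ∀ w : W, (Function.support fun n => proj n w).Finite
  proj_sum : ∀ w : W, (∑ᶠ n : ℂ, proj n w) = w
  lower_bound : ∃ B : ℝ, ∀ n : ℂ, n.re < B → proj n = 0

/-- A `ℤ`-grading of `V` with lower-bounded weights. -/
structure ZGrading where
  proj : ℤ → W →ₗ[ℂ] W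
  proj_comp : ∀ m n : ℤ, proj m ∘ₗ proj n = if m = n then proj n else 0
  proj_finite : ∀ w : W, (Function.support fun n => proj n w).Finite
  proj_sum : ∀ w : W, (∑ᶠ n : ℤ, proj n w) = w
  lower_bound : ∃ B : ℤ, ∀ n : ℤ, n < B → proj n = 0

variable {W}

/-- The grading operator `d` of a `ℂ`-graded space. -/
def CGrading.d (G : CGrading W) (w : W) : W := ∑ᶠ n : ℂ, n • G.proj n w

/-- The grading operator `d` of a `ℤ`-graded space. -/
def ZGrading.d (G : ZGrading W) (v : W) : W := ∑ᶠ n : ℤ, (n : ℂ) • G.proj n v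

/-- The operator `z^d` on a `ℤ`-graded space. -/
def ZGrading.zd (G : ZGrading W) (z : ℂ) (v : W) : W := ∑ᶠ n : ℤ, (z ^ n) • G.proj n v

/-- The algebraic completion `∏ₙ W_[n]`, realized as the submodule of functions
`ℂ → W` recording a homogeneous component in each weight. -/
def CGrading.compSub (G : CGrading W) : Submodule ℂ (ℂ → W) where
  carrier := {f | ∀ n, G.proj n (f n) = f n}
  add_mem' := by
    intro a b ha hb n
    simp only [Pi.add_apply, map_add, ha n, hb n]
  zero_mem' := by
    intro n
    simp
  smul_mem' := by
    intro c f hf n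
    simp only [Pi.smul_apply, map_smul, hf n]

/-- The algebraic completion of a graded space. -/
abbrev CGrading.Comp (G : CGrading W) : Type _ := ↥G.compSub

/-- The pairing between the graded dual and the algebraic completion. -/
def CGrading.pair (G : CGrading W) (φ : W →ₗ[ℂ] ℂ) (f : G.Comp) : ℂ :=
  ∑ᶠ n : ℂ, φ (f.1 n)

/-- The embedding of `W` into its algebraic completion. -/
def CGrading.emb (G : CGrading W) (w : W) : G.Comp :=
  ⟨fun n => G.proj n w, by
    intro n
    have h := congrArg (fun T : W →ₗ[ℂ] W => T w) (G.proj_comp n n)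
    simpa using h⟩

/-- The componentwise extension of an operator on `W` to the algebraic completion. -/
def CGrading.ext (G : CGrading W) (L : W → W) (f : G.Comp) : G.Comp :=
  ⟨fun m => ∑ᶠ n : ℂ, G.proj m (L (f.1 n)), by
    intro m
    show G.proj m (∑ᶠ n : ℂ, G.proj m (L (f.1 n))) = ∑ᶠ n : ℂ, G.proj m (L (f.1 n))
    by_cases h : (Function.support fun n => G.proj m (L (f.1 n))).Finite
    · have h1 := AddMonoidHom.map_finsum (G.proj m).toAddMonoidHom h
      simp only [LinearMap.toAddMonoidHom_coe] at h1
      rw [h1]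
      refine finsum_congr fun n => ?_
      have h2 := congrArg (fun T : W →ₗ[ℂ] W => T (L (f.1 n))) (G.proj_comp m m)
      simpa using h2
    · rw [finsum_of_infinite_support h]
      simp⟩

/-- The operator `z^d` on the algebraic completion, acting on the component of
weight `n` by `z ^ n` (complex power). -/
def CGrading.zd (G : CGrading W) (z : ℂ) (f : G.Comp) : G.Comp :=
  ⟨fun n => (z ^ n) • f.1 n, by
    intro n
    rw [map_smul, f.2 n]⟩

end Graded


section VOA

/-- A meromorphic open-string vertex algebra (MOSVA): a lower-bounded `ℤ`-graded
space with a vertex operator map (recorded through its coefficients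
`Y u v k = (Y_V)_k(u)v`, the coefficient of `x^{-k-1}` in `Y_V(u,x)v`) and a
vacuum, satisfying the grading, vacuum, `D`-derivative/commutator, rationality and
associativity axioms. -/
structure MOSVA (V : Type*) [AddCommGroup V] [Module ℂ V] where
  gr : ZGrading V
  Y : V →ₗ[ℂ] V →ₗ[ℂ] (ℤ → V)
  vac : V
  /-- lower truncation of vertex operators -/
  trunc : ∀ u v : V, ∃ N : ℤ, ∀ k : ℤ, N ≤ k → Y u v k = 0
  /-- identity property `Y(𝟏,x) = 1` -/
  identity : ∀ (v : V) (k : ℤ), Y vac v k = if k = -1 then v else 0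
  /-- creation property: `Y(u,x)𝟏 ∈ V[[x]]` and `lim_{x→0} Y(u,x)𝟏 = u` -/
  creation : ∀ (u : V) (k : ℤ), 0 ≤ k → Y u vac k = 0
  creation_lim : ∀ u : V, Y u vac (-1) = u
  /-- the `d`-commutator formula, written in terms of coefficients -/
  d_comm : ∀ (u v : V) (k : ℤ),
    gr.d (Y u v k) = Y (gr.d u) v k + (-(k : ℂ) - 1) • Y u v k + Y u (gr.d v) k
  /-- the `D`-derivative property (`D_V u = (Y_V)_{-2}(u)𝟏`) -/
  D_deriv : ∀ (u v : V) (k : ℤ),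
    Y (Y u vac (-2)) v k = (-(k : ℂ)) • Y u v (k - 1)
  /-- the `D`-commutator formula -/
  D_comm : ∀ (u v : V) (k : ℤ),
    Y (Y u v k) vac (-2) - Y u (Y v vac (-2)) k = (-(k : ℂ)) • Y u v (k - 1)
  /-- rationality of products: matrix coefficients of products of vertex operators
  converge absolutely in the ordered region to rational functions with the only
  possible poles at `z i = 0` and `z i = z j` -/
  rationality : ∀ (n : ℕ) (u : Fin n → V) (v : V) (φ : V →ₗ[ℂ] ℂ),
    InGradedDual gr.proj φ → ∃ R : RatFn (Fin n), ∀ z : Fin n → ℂ, OrderedPos z →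
      AbsConvTo (fun k : Fin n → ℤ =>
          φ (compApply n (fun i x => Y (u i) x (k i)) v) * ∏ i, z i ^ (-(k i) - 1))
        (R.eval z)
  /-- rationality of iterates and associativity: products and iterates converge to a
  common rational function -/
  associativity : ∀ (u₁ u₂ v : V) (φ : V →ₗ[ℂ] ℂ), InGradedDual gr.proj φ →
    ∃ R : RatFn (Fin 2),
      (∀ z₁ z₂ : ℂ, ‖z₂‖ < ‖z₁‖ → 0 < ‖z₂‖ →
        AbsConvTo (fun k : ℤ × ℤ =>
            φ (Y u₁ (Y u₂ v k.2) k.1) * z₁ ^ (-k.1 - 1) * z₂ ^ (-k.2 - 1))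
          (R.eval ![z₁, z₂])) ∧
      (∀ z₁ z₂ : ℂ, ‖z₁ - z₂‖ < ‖z₂‖ → 0 < ‖z₁ - z₂‖ →
        AbsConvTo (fun k : ℤ × ℤ =>
            φ (Y (Y u₁ u₂ k.1) v k.2) * (z₁ - z₂) ^ (-k.1 - 1) * z₂ ^ (-k.2 - 1))
          (R.eval ![z₁, z₂]))

variable {V : Type*} [AddCommGroup V] [Module ℂ V]

/-- The operator `D_V`. -/
def MOSVA.D (A : MOSVA V) (v : V) : V := A.Y v A.vac (-2)

/-- The pole-order condition for a MOSVA. -/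
def MOSVA.PoleOrder (A : MOSVA V) : Prop :=
  ∀ u₁ v : V, ∃ C : ℕ, ∀ φ : V →ₗ[ℂ] ℂ, InGradedDual A.gr.proj φ → ∀ u₂ : V,
    ∃ R : RatFn (Fin 2), R.a 0 ≤ C ∧
      ∀ z₁ z₂ : ℂ, ‖z₂‖ < ‖z₁‖ → 0 < ‖z₂‖ →
        AbsConvTo (fun k : ℤ × ℤ =>
            φ (A.Y u₁ (A.Y u₂ v k.2) k.1) * z₁ ^ (-k.1 - 1) * z₂ ^ (-k.2 - 1))
          (R.eval ![z₁, z₂])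

/-- A bimodule for a MOSVA: a `ℂ`-graded space with left and right vertex operator
maps (recorded through their coefficients), satisfying the left module, right module
and compatibility axioms. -/
structure Bimod (A : MOSVA V) (W : Type*) [AddCommGroup W] [Module ℂ W] where
  gr : CGrading W
  YL : V →ₗ[ℂ] W →ₗ[ℂ] (ℤ → W)
  YR : W →ₗ[ℂ] V →ₗ[ℂ] (ℤ → W)
  DW : W →ₗ[ℂ] W
  /-- `D_W` has weight one -/
  DW_wt : ∀ n : ℂ, DW ∘ₗ gr.proj n = gr.proj (n + 1) ∘ₗ DW ∘ₗ gr.proj n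
  truncL : ∀ (u : V) (w : W), ∃ N : ℤ, ∀ k : ℤ, N ≤ k → YL u w k = 0
  truncR : ∀ (w : W) (u : V), ∃ N : ℤ, ∀ k : ℤ, N ≤ k → YR w u k = 0
  identityL : ∀ (w : W) (k : ℤ), YL A.vac w k = if k = -1 then w else 0
  creationR : ∀ (w : W) (k : ℤ), 0 ≤ k → YR w A.vac k = 0
  creationR_lim : ∀ w : W, YR w A.vac (-1) = w
  d_commL : ∀ (u : V) (w : W) (k : ℤ),
    gr.d (YL u w k) = YL (A.gr.d u) w k + (-(k : ℂ) - 1) • YL u w k + YL u (gr.d w) k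
  d_commR : ∀ (w : W) (u : V) (k : ℤ),
    gr.d (YR w u k) = YR (gr.d w) u k + (-(k : ℂ) - 1) • YR w u k + YR w (A.gr.d u) k
  D_derivL : ∀ (u : V) (w : W) (k : ℤ),
    YL (A.D u) w k = (-(k : ℂ)) • YL u w (k - 1)
  D_commL : ∀ (u : V) (w : W) (k : ℤ),
    DW (YL u w k) - YL u (DW w) k = (-(k : ℂ)) • YL u w (k - 1)
  D_derivR : ∀ (w : W) (u : V) (k : ℤ),
    YR (DW w) u k = (-(k : ℂ)) • YR w u (k - 1)
  D_commR : ∀ (w : W) (u : V) (k : ℤ),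
    DW (YR w u k) - YR w (A.D u) k = (-(k : ℂ)) • YR w u (k - 1)
  /-- rationality for products of left vertex operators -/
  rationalityL : ∀ (n : ℕ) (u : Fin n → V) (w : W) (φ : W →ₗ[ℂ] ℂ),
    InGradedDual gr.proj φ → ∃ R : RatFn (Fin n), ∀ z : Fin n → ℂ, OrderedPos z →
      AbsConvTo (fun k : Fin n → ℤ =>
          φ (compApply n (fun i x => YL (u i) x (k i)) w) * ∏ i, z i ^ (-(k i) - 1))
        (R.eval z)
  /-- rationality of iterates and associativity for the left vertex operator map -/
  associativityL : ∀ (u₁ u₂ : V) (w : W) (φ : W →ₗ[ℂ] ℂ), InGradedDual gr.proj φ →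
    ∃ R : RatFn (Fin 2),
      (∀ z₁ z₂ : ℂ, ‖z₂‖ < ‖z₁‖ → 0 < ‖z₂‖ →
        AbsConvTo (fun k : ℤ × ℤ =>
            φ (YL u₁ (YL u₂ w k.2) k.1) * z₁ ^ (-k.1 - 1) * z₂ ^ (-k.2 - 1))
          (R.eval ![z₁, z₂])) ∧
      (∀ z₁ z₂ : ℂ, ‖z₁ - z₂‖ < ‖z₂‖ → 0 < ‖z₁ - z₂‖ →
        AbsConvTo (fun k : ℤ × ℤ =>
            φ (YL (A.Y u₁ u₂ k.1) w k.2) * (z₁ - z₂) ^ (-k.1 - 1) * z₂ ^ (-k.2 - 1))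
          (R.eval ![z₁, z₂]))
  /-- rationality for products `Y_W^R(w,z₁)Y_V(u₁,z₂)⋯Y_V(u_{n-1},z_n)u_n` -/
  rationalityR : ∀ (n : ℕ) (w : W) (v : Fin (n+1) → V) (φ : W →ₗ[ℂ] ℂ),
    InGradedDual gr.proj φ → ∃ R : RatFn (Fin (n+1)),
      ∀ z : Fin (n+1) → ℂ, OrderedPos z →
        AbsConvTo (fun k : Fin (n+1) → ℤ =>
            φ (YR w (compApply n (fun i x => A.Y (v i.castSucc) x (k i.succ))
                (v (Fin.last n))) (k 0)) * ∏ i, z i ^ (-(k i) - 1))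
          (R.eval z)
  /-- rationality of iterates and associativity for the right vertex operator map -/
  associativityR : ∀ (w : W) (u₁ u₂ : V) (φ : W →ₗ[ℂ] ℂ), InGradedDual gr.proj φ →
    ∃ R : RatFn (Fin 2),
      (∀ z₁ z₂ : ℂ, ‖z₂‖ < ‖z₁‖ → 0 < ‖z₂‖ →
        AbsConvTo (fun k : ℤ × ℤ =>
            φ (YR w (A.Y u₁ u₂ k.2) k.1) * z₁ ^ (-k.1 - 1) * z₂ ^ (-k.2 - 1))
          (R.eval ![z₁, z₂])) ∧
      (∀ z₁ z₂ : ℂ, ‖z₁ - z₂‖ < ‖z₂‖ → 0 < ‖z₁ - z₂‖ →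
        AbsConvTo (fun k : ℤ × ℤ =>
            φ (YR (YR w u₁ k.1) u₂ k.2) * (z₁ - z₂) ^ (-k.1 - 1) * z₂ ^ (-k.2 - 1))
          (R.eval ![z₁, z₂]))
  /-- compatibility: rationality of mixed products
  `Y_W^L(u₁,z₁)⋯Y_W^L(u_p,z_p)Y_W^R(w,z₀)Y_V(v₁,⋅)⋯Y_V(v_{q},⋅)v_{q+1}` -/
  compatRat : ∀ (p q : ℕ) (u : Fin p → V) (w : W) (v : Fin (q+1) → V)
      (φ : W →ₗ[ℂ] ℂ), InGradedDual gr.proj φ →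
    ∃ R : RatFn (Fin p ⊕ Fin (q+1)),
      ∀ (zL : Fin p → ℂ) (z0 : ℂ) (zR : Fin q → ℂ),
        Ordered zL → (∀ i, ‖z0‖ < ‖zL i‖) → (∀ j, ‖zR j‖ < ‖z0‖) → Ordered zR →
        0 < ‖z0‖ → (∀ j, 0 < ‖zR j‖) →
        AbsConvTo (fun K : (Fin p → ℤ) × ℤ × (Fin q → ℤ) =>
            φ (compApply p (fun i x => YL (u i) x (K.1 i))
                (YR w (compApply q (fun j x => A.Y (v j.castSucc) x (K.2.2 j))
                  (v (Fin.last q))) K.2.1))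
              * (∏ i, zL i ^ (-(K.1 i) - 1)) * z0 ^ (-K.2.1 - 1)
              * ∏ j, zR j ^ (-(K.2.2 j) - 1))
          (R.eval (Sum.elim zL (Fin.cons z0 zR)))
  /-- compatibility: associativity for the left and right vertex operator maps -/
  compatAssoc : ∀ (u v : V) (w : W) (φ : W →ₗ[ℂ] ℂ), InGradedDual gr.proj φ →
    ∃ R : RatFn (Fin 2),
      (∀ z₁ z₂ : ℂ, ‖z₂‖ < ‖z₁‖ → 0 < ‖z₂‖ →
        AbsConvTo (fun k : ℤ × ℤ =>
            φ (YL u (YR w v k.2) k.1) * z₁ ^ (-k.1 - 1) * z₂ ^ (-k.2 - 1))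
          (R.eval ![z₁, z₂])) ∧
      (∀ z₁ z₂ : ℂ, ‖z₁ - z₂‖ < ‖z₂‖ → 0 < ‖z₁ - z₂‖ →
        AbsConvTo (fun k : ℤ × ℤ =>
            φ (YR (YL u w k.1) v k.2) * (z₁ - z₂) ^ (-k.1 - 1) * z₂ ^ (-k.2 - 1))
          (R.eval ![z₁, z₂]))

variable {W : Type*} [AddCommGroup W] [Module ℂ W] {A : MOSVA V}

/-- The opposite right vertex operator map
`Y_W^{s(R)}(v,x)w = e^{xD_W}Y_W^R(w,-x)v`, through its coefficients. -/
def Bimod.YsR (B : Bimod A W) (v : V) (w : W) (k : ℤ) : W :=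
  ∑ᶠ m : ℕ, (((-1 : ℂ) ^ (k + (m : ℤ) + 1)) * ((m.factorial : ℂ))⁻¹) •
    ((B.DW ^ m) (B.YR w v (k + (m : ℤ))))

/-- The pole-order condition for a bimodule over a MOSVA. -/
def Bimod.PoleOrder (B : Bimod A W) : Prop :=
  (∀ (u₁ : V) (w : W), ∃ C : ℕ, ∀ φ : W →ₗ[ℂ] ℂ, InGradedDual B.gr.proj φ → ∀ u₂ : V,
    ∃ R : RatFn (Fin 2), R.a 0 ≤ C ∧
      ∀ z₁ z₂ : ℂ, ‖z₂‖ < ‖z₁‖ → 0 < ‖z₂‖ →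
        AbsConvTo (fun k : ℤ × ℤ =>
            φ (B.YL u₁ (B.YL u₂ w k.2) k.1) * z₁ ^ (-k.1 - 1) * z₂ ^ (-k.2 - 1))
          (R.eval ![z₁, z₂])) ∧
  (∀ (u₂ : V) (w : W), ∃ C : ℕ, ∀ φ : W →ₗ[ℂ] ℂ, InGradedDual B.gr.proj φ → ∀ u₁ : V,
    ∃ R : RatFn (Fin 2), R.a 0 ≤ C ∧
      ∀ z₁ z₂ : ℂ, ‖z₂‖ < ‖z₁‖ → 0 < ‖z₂‖ →
        AbsConvTo (fun k : ℤ × ℤ =>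
            φ (B.YR w (A.Y u₁ u₂ k.2) k.1) * z₁ ^ (-k.1 - 1) * z₂ ^ (-k.2 - 1))
          (R.eval ![z₁, z₂])) ∧
  (∀ (u₁ u₂ : V), ∃ C : ℕ, ∀ φ : W →ₗ[ℂ] ℂ, InGradedDual B.gr.proj φ → ∀ w : W,
    ∃ R : RatFn (Fin 2), R.a 0 ≤ C ∧
      ∀ z₁ z₂ : ℂ, ‖z₂‖ < ‖z₁‖ → 0 < ‖z₂‖ →
        AbsConvTo (fun k : ℤ × ℤ =>
            φ (B.YL u₁ (B.YR w u₂ k.2) k.1) * z₁ ^ (-k.1 - 1) * z₂ ^ (-k.2 - 1))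
          (R.eval ![z₁, z₂]))

end VOA


section Cochains

variable {V : Type*} [AddCommGroup V] [Module ℂ V]
variable {W : Type*} [AddCommGroup W] [Module ℂ W] {A : MOSVA V}

/-- A `W̄`-valued rational function in the variables `z i`, `i : ι`, with the only
possible poles at `z i = z j`: a map from configuration space to the algebraic
completion whose pairings with graded-dual functionals are such rational functions,
with pole orders uniform in the functional, as witnessed by a formal power series
with coefficients in `W` (condition (ii)). -/
def CGrading.WTilde (G : CGrading W) {ι : Type*} [Fintype ι] [DecidableEq ι]
    (f : (ι → ℂ) → G.Comp) : Prop :=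
  (∀ φ : W →ₗ[ℂ] ℂ, InGradedDual G.proj φ →
      ∃ R : DiagRatFn ι, ∀ z : ι → ℂ, Conf z → G.pair φ (f z) = R.eval z) ∧
  ∃ (p : ι → ι → ℤ) (b : (ι → ℕ) → W),
    ∀ φ : W →ₗ[ℂ] ℂ, InGradedDual G.proj φ →
      (Function.support fun k => φ (b k)).Finite ∧
      ∀ z : ι → ℂ, Conf z →
        (∏ q ∈ Finset.univ.offDiag, (z q.1 - z q.2) ^ (p q.1 q.2)) * G.pair φ (f z)
          = ∑ᶠ k : ι → ℕ, φ (b k) * ∏ i, z i ^ (k i)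

/-- The pattern of left/right vertex operators: the `i`-th operator is
`Y_W^L(u i, z i)` if `isL i`, and `Y_W^{s(R)}(u i, z i)` otherwise; `k` records the
coefficient extracted from each operator. -/
def patOps (B : Bimod A W) {n : ℕ} (isL : Fin n → Bool) (u : Fin n → V)
    (k : Fin n → ℤ) : Fin n → (W → W) :=
  fun i => if isL i then fun x => B.YL (u i) x (k i) else fun x => B.YsR (u i) x (k i)

/-- The pattern with `l` left operators followed by `n - l` opposite right operators. -/
def prefixPat (n l : ℕ) : Fin n → Bool := fun i => decide ((i : ℕ) < l)

/-- A vector `w` such that `Y_W^L(u,x)w ∈ W[[x]]` and `Y_W^{s(R)}(u,x)w ∈ W[[x]]`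
for every `u ∈ V`. -/
def Bimod.RegVec (B : Bimod A W) (w : W) : Prop :=
  ∀ (u : V) (k : ℤ), 0 ≤ k → B.YL u w k = 0 ∧ B.YsR u w k = 0

/-- `f` represents the `W̄`-valued rational function
`E(Y^{L/sR}(u 0, z 0)⋯Y^{L/sR}(u (n-1), z (n-1)) w)` (with the operators prescribed
by the pattern `isL`): `f` is a `W̄`-valued rational function with only diagonal
poles whose pairings are the sums of the corresponding series of matrix coefficients
on the region `|z 0| > ⋯ > |z (n-1)| > 0`. -/
def RepEPat (B : Bimod A W) {n : ℕ} (isL : Fin n → Bool) (u : Fin n → V) (w : W)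
    (f : (Fin n → ℂ) → B.gr.Comp) : Prop :=
  B.gr.WTilde f ∧
  ∀ φ : W →ₗ[ℂ] ℂ, InGradedDual B.gr.proj φ → ∀ z : Fin n → ℂ, OrderedPos z →
    AbsConvTo (fun k : Fin n → ℤ =>
        φ (compApply n (patOps B isL u k) w) * ∏ i, z i ^ (-(k i) - 1))
      (B.gr.pair φ (f z))

/-- `f` represents the `W̄`-valued rational function given by a product of groups of
vertex operators, with group `i` of size `α i` and left/right pattern `isL`;
the variables are indexed by the sigma type `(i : Fin N) × Fin (α i)`. -/
def RepESig (B : Bimod A W) {N : ℕ} (α : Fin N → ℕ)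
    (isL : (i : Fin N) → Fin (α i) → Bool)
    (u : (i : Fin N) → Fin (α i) → V) (w : W)
    (f : (((i : Fin N) × Fin (α i)) → ℂ) → B.gr.Comp) : Prop :=
  B.gr.WTilde f ∧
  ∀ φ : W →ₗ[ℂ] ℂ, InGradedDual B.gr.proj φ →
    ∀ Z : (i : Fin N) → Fin (α i) → ℂ,
      (∀ (i : Fin N) (s t : Fin (α i)), s < t → ‖Z i t‖ < ‖Z i s‖) →
      (∀ (i j : Fin N), i < j → ∀ (s : Fin (α i)) (t : Fin (α j)), ‖Z j t‖ < ‖Z i s‖) →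
      (∀ (i : Fin N) (s : Fin (α i)), 0 < ‖Z i s‖) →
      AbsConvTo (fun K : (i : Fin N) → Fin (α i) → ℤ =>
          φ (compApply N (fun i x => compApply (α i) (fun s y =>
              if isL i s then B.YL (u i s) y (K i s) else B.YsR (u i s) y (K i s)) x) w)
            * ∏ i, ∏ s, Z i s ^ (-(K i s) - 1))
        (B.gr.pair φ (f (fun q => Z q.1 q.2)))

/-- Multilinearity of a map on `n`-tuples of vectors. -/
def IsMultilinear {M : Type*} [AddCommMonoid M] [Module ℂ M] {n : ℕ}
    (Φ : (Fin n → V) → M) : Prop :=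
  (∀ (v : Fin n → V) (i : Fin n) (x y : V),
      Φ (Function.update v i (x + y)) = Φ (Function.update v i x) + Φ (Function.update v i y)) ∧
  ∀ (v : Fin n → V) (i : Fin n) (c : ℂ) (x : V),
      Φ (Function.update v i (c • x)) = c • Φ (Function.update v i x)

/-- The `D`-derivative property of a map `Φ : V^{⊗n} → W̃_{z₁,…,zₙ}`. -/
def DDerivProp (A : MOSVA V) (B : Bimod A W) {n : ℕ}
    (Φ : (Fin n → V) → (Fin n → ℂ) → B.gr.Comp) : Prop :=
  (∀ (v : Fin n → V) (i : Fin n) (φ : W →ₗ[ℂ] ℂ), InGradedDual B.gr.proj φ →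
    ∀ z : Fin n → ℂ, Conf z →
      HasDerivAt (fun t : ℂ => B.gr.pair φ (Φ v (Function.update z i t)))
        (B.gr.pair φ (Φ (Function.update v i (A.D (v i))) z)) (z i)) ∧
  (∀ (v : Fin n → V) (φ : W →ₗ[ℂ] ℂ), InGradedDual B.gr.proj φ →
    ∀ z : Fin n → ℂ, Conf z →
      B.gr.pair φ (B.gr.ext (⇑B.DW) (Φ v z)) =
        ∑ i, B.gr.pair φ (Φ (Function.update v i (A.D (v i))) z))

/-- The `d`-conjugation property of a map `Φ : V^{⊗n} → W̃_{z₁,…,zₙ}`. -/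
def DConjProp (A : MOSVA V) (B : Bimod A W) {n : ℕ}
    (Φ : (Fin n → V) → (Fin n → ℂ) → B.gr.Comp) : Prop :=
  ∀ (v : Fin n → V) (φ : W →ₗ[ℂ] ℂ), InGradedDual B.gr.proj φ →
    ∀ (z : Fin n → ℂ) (c : ℂ), c ≠ 0 → Conf z → Conf (fun i => c * z i) →
      B.gr.pair φ (B.gr.zd c (Φ v z)) =
        B.gr.pair φ (Φ (fun i => A.gr.zd c (v i)) (fun i => c * z i))

/-- Composability of `Φ : V^{⊗n} → W̃` with `m` vertex operators. -/
def ComposableWith (A : MOSVA V) (B : Bimod A W) (n m : ℕ)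
    (Φ : (Fin n → V) → (Fin n → ℂ) → B.gr.Comp) : Prop :=
  ∃ Cb : V → V → ℕ,
  ∀ (α : Fin (n+1) → ℕ), (∑ i, α i) = m + n →
  ∀ l₀ : ℕ, l₀ ≤ α 0 →
  ∀ u : (i : Fin (n+1)) → Fin (α i) → V,
  ∀ φ : W →ₗ[ℂ] ℂ, InGradedDual B.gr.proj φ →
  ∃ R : DiagRatFn ((i : Fin (n+1)) × Fin (α i)),
    (∀ q q' : (i : Fin (n+1)) × Fin (α i), R.b q q' ≤ Cb (u q.1 q.2) (u q'.1 q'.2)) ∧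
    ∀ (z : (i : Fin (n+1)) → Fin (α i) → ℂ) (ζ : Fin n → ℂ),
      (∀ s t : Fin (α 0), s < t → ‖z 0 t‖ < ‖z 0 s‖) →
      (∀ (j : Fin (α 0)) (i : Fin n) (t : Fin (α i.succ)),
          ‖ζ i‖ + ‖z i.succ t - ζ i‖ < ‖z 0 j‖) →
      (∀ (i : Fin n) (s t : Fin (α i.succ)), s < t →
          ‖z i.succ t - ζ i‖ < ‖z i.succ s - ζ i‖) →
      (∀ (i j : Fin n), i < j → ∀ (s : Fin (α i.succ)) (t : Fin (α j.succ)),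
          ‖(z i.succ s - ζ i) - (z j.succ t - ζ j)‖ < ‖ζ i - ζ j‖) →
      AbsConvTo (fun K : (i : Fin (n+1)) → Fin (α i) → ℤ =>
          B.gr.pair φ
            (compApply (α 0) (fun j => B.gr.ext (fun x =>
                if (j : ℕ) < l₀ then B.YL (u 0 j) x (K 0 j) else B.YsR (u 0 j) x (K 0 j)))
              (Φ (fun i => compApply (α i.succ)
                    (fun s x => A.Y (u i.succ s) x (K i.succ s)) A.vac) ζ))
            * (∏ j, z 0 j ^ (-(K 0 j) - 1))
            * ∏ i : Fin n, ∏ s, (z i.succ s - ζ i) ^ (-(K i.succ s) - 1))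
        (R.eval (fun q => z q.1 q.2))

/-- The set `Ĉ^n_m(V,W)`: maps `V^{⊗n} → W̃_{z₁,…,zₙ}` that are linear, satisfy the
`D`-derivative and `d`-conjugation properties and are composable with `m` vertex
operators. -/
def IsCochain (A : MOSVA V) (B : Bimod A W) (n m : ℕ)
    (Φ : (Fin n → V) → (Fin n → ℂ) → B.gr.Comp) : Prop :=
  IsMultilinear Φ ∧ (∀ v, B.gr.WTilde (Φ v)) ∧ DDerivProp A B Φ ∧ DConjProp A B Φ ∧
    ComposableWith A B n m Φ

/-- `Ψ` represents `E_W^{(1,0)} ∘₂ Φ`, i.e. the map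
`v ↦ E(Y_W^L(v 0, z 0) Φ(v 1 ⊗ ⋯ ⊗ v n)(z 1,…,z n))`. -/
def RepLeft (A : MOSVA V) (B : Bimod A W) {n : ℕ}
    (Φ : (Fin n → V) → (Fin n → ℂ) → B.gr.Comp)
    (Ψ : (Fin (n+1) → V) → (Fin (n+1) → ℂ) → B.gr.Comp) : Prop :=
  (∀ v, B.gr.WTilde (Ψ v)) ∧
  ∀ (v : Fin (n+1) → V) (φ : W →ₗ[ℂ] ℂ), InGradedDual B.gr.proj φ →
    ∀ (z₀ : ℂ) (zt : Fin n → ℂ), Conf (Fin.cons z₀ zt) →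
      (∀ i, ‖zt i‖ < ‖z₀‖) → (∀ i, 0 < ‖zt i‖) →
      AbsConvTo (fun k : ℤ =>
          B.gr.pair φ (B.gr.ext (fun x => B.YL (v 0) x k) (Φ (Fin.tail v) zt))
            * z₀ ^ (-k - 1))
        (B.gr.pair φ (Ψ v (Fin.cons z₀ zt)))

/-- `Ψ` represents `E_W^{(0,1)} ∘₂ Φ`, i.e. the map
`v ↦ E(Y_W^{s(R)}(v (n+1), z (n+1)) Φ(v 1 ⊗ ⋯ ⊗ v n)(z 1,…,z n))`. -/
def RepRight (A : MOSVA V) (B : Bimod A W) {n : ℕ}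
    (Φ : (Fin n → V) → (Fin n → ℂ) → B.gr.Comp)
    (Ψ : (Fin (n+1) → V) → (Fin (n+1) → ℂ) → B.gr.Comp) : Prop :=
  (∀ v, B.gr.WTilde (Ψ v)) ∧
  ∀ (v : Fin (n+1) → V) (φ : W →ₗ[ℂ] ℂ), InGradedDual B.gr.proj φ →
    ∀ (zl : ℂ) (zi : Fin n → ℂ), Conf (Fin.snoc zi zl) →
      (∀ i, ‖zi i‖ < ‖zl‖) → (∀ i, 0 < ‖zi i‖) →
      AbsConvTo (fun k : ℤ =>
          B.gr.pair φ (B.gr.ext (fun x => B.YsR (v (Fin.last n)) x k) (Φ (Fin.init v) zi))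
            * zl ^ (-k - 1))
        (B.gr.pair φ (Ψ v (Fin.snoc zi zl)))

/-- Replace the two adjacent entries `i, i+1` of an `(n+1)`-tuple by a single entry. -/
def mergeAt {M : Type*} {n : ℕ} (i : Fin n) (v : Fin (n+1) → M) (a : M) : Fin n → M :=
  fun j => if j < i then v j.castSucc else if j = i then a else v j.succ

/-- `Ψ` represents `Φ ∘ᵢ E_V^{(2)}`, i.e. the map
`v ↦ E(Φ(v 1 ⊗ ⋯ ⊗ Y_V(v i, z i − ζ)Y_V(v (i+1), z (i+1) − ζ)𝟏 ⊗ ⋯ ⊗ v (n+1))(…,ζ,…))`. -/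
def RepCirc (A : MOSVA V) (B : Bimod A W) {n : ℕ} (i : Fin n)
    (Φ : (Fin n → V) → (Fin n → ℂ) → B.gr.Comp)
    (Ψ : (Fin (n+1) → V) → (Fin (n+1) → ℂ) → B.gr.Comp) : Prop :=
  (∀ v, B.gr.WTilde (Ψ v)) ∧
  ∀ (v : Fin (n+1) → V) (φ : W →ₗ[ℂ] ℂ), InGradedDual B.gr.proj φ →
    ∀ (z : Fin (n+1) → ℂ) (ζ : ℂ), Conf z → Conf (mergeAt i z ζ) →
      ‖z i.succ - ζ‖ < ‖z i.castSucc - ζ‖ → 0 < ‖z i.succ - ζ‖ →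
      (∀ j : Fin (n+1), j ≠ i.castSucc → j ≠ i.succ →
        ‖z i.castSucc - ζ‖ < ‖z j - z i.castSucc‖ ∧ ‖z i.succ - ζ‖ < ‖z j - z i.succ‖) →
      AbsConvTo (fun k : ℤ × ℤ =>
          B.gr.pair φ
            (Φ (mergeAt i v (A.Y (v i.castSucc) (A.Y (v i.succ) A.vac k.2) k.1))
              (mergeAt i z ζ))
            * (z i.castSucc - ζ) ^ (-k.1 - 1) * (z i.succ - ζ) ^ (-k.2 - 1))
        (B.gr.pair φ (Ψ v z))

/-- `Ψ` represents the coboundary `δ̂Φ = E_W^{(1,0)}∘₂Φ + Σᵢ (−1)^i Φ∘ᵢE_V^{(2)}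
+ (−1)^{n+1} E_W^{(0,1)}∘₂Φ` of the `n`-cochain `Φ`. -/
def IsDelta (A : MOSVA V) (B : Bimod A W) {n : ℕ}
    (Φ : (Fin n → V) → (Fin n → ℂ) → B.gr.Comp)
    (Ψ : (Fin (n+1) → V) → (Fin (n+1) → ℂ) → B.gr.Comp) : Prop :=
  ∃ (gL gR : (Fin (n+1) → V) → (Fin (n+1) → ℂ) → B.gr.Comp)
    (gC : Fin n → (Fin (n+1) → V) → (Fin (n+1) → ℂ) → B.gr.Comp),
    RepLeft A B Φ gL ∧ RepRight A B Φ gR ∧ (∀ i, RepCirc A B i Φ (gC i)) ∧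
    ∀ v z, Ψ v z = gL v z + (∑ i : Fin n, ((-1 : ℂ) ^ ((i : ℕ) + 1)) • gC i v z)
      + ((-1 : ℂ) ^ (n + 1)) • gR v z

end Cochains

lemma absConvTo_iff {ι : Type*} {f : ι → ℂ} {s : ℂ} : AbsConvTo f s ↔ HasSum f s :=
  ⟨fun h => h.2, fun h => ⟨h.summable.norm, h⟩⟩

lemma powerSeries_coeff_unique {a b : ℕ → ℂ} {ε : ℝ} (hε : 0 < ε)
    (h : ∀ x : ℝ, 0 < x → x < ε → ∃ T, HasSum (fun n => a n * (x : ℂ) ^ n) T ∧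
      HasSum (fun n => b n * (x : ℂ) ^ n) T) : a = b := by
  set p := FormalMultilinearSeries.ofScalars ℂ (a - b) with hp
  have hz : ∀ x : ℝ, 0 < x → x < ε → HasSum (fun n => (a - b) n * (x : ℂ) ^ n) 0 := by
    intro x hx hxε
    obtain ⟨T, h1, h2⟩ := h x hx hxε
    simpa [sub_mul] using h1.sub h2
  have hr : 0 < p.radius := by
    have h1 := (hz (ε / 2) (by linarith) (by linarith)).summable.norm
    obtain ⟨r, hr⟩ : ∃ r : NNReal, (r : ℝ) = ε / 2 := ⟨⟨ε / 2, by linarith⟩, rfl⟩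
    refine lt_of_lt_of_le ?_ (p.le_radius_of_summable (r := r) ?_)
    · rw [ENNReal.coe_pos, ← NNReal.coe_pos, hr]
      linarith
    · refine h1.congr fun n => ?_
      rw [hp, FormalMultilinearSeries.ofScalars_norm, norm_mul, norm_pow, Complex.norm_real,
        Real.norm_of_nonneg (by linarith), hr]
  by_contra hab
  have hpne : p ≠ 0 := by
    rw [hp, Ne, FormalMultilinearSeries.ofScalars_series_eq_zero]
    exact fun h0 => hab (sub_eq_zero.mp h0)
  have hloc := (p.hasFPowerSeriesOnBall hr).hasFPowerSeriesAt.locally_ne_zero hpne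
  have htend : Filter.Tendsto (fun x : ℝ => (x : ℂ)) (nhdsWithin 0 (Set.Ioi 0))
      (nhdsWithin 0 {0}ᶜ) := by
    refine tendsto_nhdsWithin_iff.mpr ⟨?_, ?_⟩
    · have : Filter.Tendsto (fun x : ℝ => (x : ℂ)) (nhds 0) (nhds ((0 : ℝ) : ℂ)) :=
        Complex.continuous_ofReal.tendsto 0
      simpa using this.mono_left nhdsWithin_le_nhds
    · filter_upwards [self_mem_nhdsWithin] with x hx
      simpa using (ne_of_gt hx : x ≠ 0)
  obtain ⟨x, hx, hx'⟩ := ((htend.eventually hloc).and (Ioo_mem_nhdsGT hε)).exists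
  refine hx ?_
  have := (hz x hx'.1 hx'.2).tsum_eq
  rw [FormalMultilinearSeries.sum]
  simpa [hp, FormalMultilinearSeries.ofScalars_apply_eq, mul_comm] using this

lemma hasSum_int_iff_nat {f : ℤ → ℂ} {M : ℤ} (hf : ∀ k < M, f k = 0) (T : ℂ) :
    HasSum (fun n : ℕ => f (M + n)) T ↔ HasSum f T := by
  refine Function.Injective.hasSum_iff (g := fun n : ℕ => M + (n : ℤ))
    (fun m n h => by simpa using h) fun k hk => hf k ?_
  by_contra hkM
  exact hk ⟨(k - M).toNat, by simp only; omega⟩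

lemma laurentSeries_coeff_unique {a b : ℤ → ℂ} {M : ℤ} (ha : ∀ k < M, a k = 0)
    (hb : ∀ k < M, b k = 0) {ε : ℝ} (hε : 0 < ε)
    (h : ∀ x : ℝ, 0 < x → x < ε → ∃ T, HasSum (fun k => a k * (x : ℂ) ^ k) T ∧
      HasSum (fun k => b k * (x : ℂ) ^ k) T) : a = b := by
  have key : (fun n : ℕ => a (M + n)) = fun n : ℕ => b (M + n) := by
    refine powerSeries_coeff_unique hε fun x hx hxε => ?_
    obtain ⟨T, h1, h2⟩ := h x hx hxε
    have hx0 : (x : ℂ) ≠ 0 := by exact_mod_cast hx.ne'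
    have aux : ∀ c : ℤ → ℂ, (∀ k < M, c k = 0) → HasSum (fun k => c k * (x : ℂ) ^ k) T →
        HasSum (fun n : ℕ => c (M + n) * (x : ℂ) ^ n) (T * (x : ℂ) ^ (-M)) := by
      intro c hc hT
      rw [← hasSum_int_iff_nat (M := M) (fun k hk => by simp [hc k hk])] at hT
      refine (hT.mul_right ((x : ℂ) ^ (-M))).congr_fun fun n => ?_
      rw [mul_assoc, ← zpow_add₀ hx0]
      simp
    exact ⟨_, aux a ha h1, aux b hb h2⟩
  funext k
  by_cases hk : k < M
  · rw [ha k hk, hb k hk]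
  · have := congrFun key (k - M).toNat
    rwa [show M + ((k - M).toNat : ℤ) = k by omega] at this

lemma doubleSeries_coeff_unique {c e : ℤ × ℤ → ℂ} {M L : ℤ}
    (hc : ∀ p, c p ≠ 0 → M ≤ p.1 ∧ p.1 + p.2 ≤ L) (he : ∀ p, e p ≠ 0 → M ≤ p.1 ∧ p.1 + p.2 ≤ L)
    {ε : ℝ} (hε : 0 < ε) {T : ℤ → ℝ → ℂ} {K : ℝ → ℝ → ℂ}
    (hT : ∀ t x, 0 < x → x < ε → HasSum (fun a : ℤ => c (a, t - a) * (x : ℂ) ^ a) (T t x))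
    (hK : ∀ x u, 0 < x → x < ε → 0 < u → u < ε →
      HasSum (fun t : ℤ => T t x * (u : ℂ) ^ (-t)) (K x u))
    (hE : ∀ x u, 0 < x → x < ε → 0 < u → u < ε →
      HasSum (fun p : ℤ × ℤ => e p * ((x : ℂ) ^ p.1 * (u : ℂ) ^ (-(p.1 + p.2)))) (K x u)) :
    c = e := by
  have vanish : ∀ g : ℤ × ℤ → ℂ, (∀ p, g p ≠ 0 → M ≤ p.1 ∧ p.1 + p.2 ≤ L) →
      ∀ p : ℤ × ℤ, (p.1 < M ∨ L < p.1 + p.2) → g p = 0 := by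
    intro g hg p hp
    by_contra h0
    have := hg p h0
    omega
  let σ : ℤ × ℤ ≃ ℤ × ℤ :=
    { toFun := fun q => (q.2, q.1 - q.2)
      invFun := fun p => (p.1 + p.2, p.1)
      left_inv := fun q => by ext <;> simp
      right_inv := fun p => by ext <;> simp }
  have hdiag : ∀ x u, 0 < x → x < ε → 0 < u → u < ε →
      HasSum (fun q : ℤ × ℤ => e (q.2, q.1 - q.2) * (x : ℂ) ^ q.2 * (u : ℂ) ^ (-q.1))
        (K x u) := by
    intro x u hx hxε hu huε
    have h := (σ.hasSum_iff).mpr (hE x u hx hxε hu huε)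
    refine h.congr_fun fun q => ?_
    simp only [Function.comp_apply, σ, Equiv.coe_fn_mk, add_sub_cancel, mul_assoc]
  have hsum : ∀ x, 0 < x → x < ε → ∀ t : ℤ,
      Summable fun a : ℤ => e (a, t - a) * (x : ℂ) ^ a := by
    intro x hx hxε t
    have hu : ((ε / 2 : ℝ) : ℂ) ≠ 0 := by exact_mod_cast (by linarith : ε / 2 ≠ 0)
    have h := (hdiag x (ε / 2) hx hxε (by linarith) (by linarith)).summable.prod_factor t
    simp only at h
    exact (summable_mul_right_iff (zpow_ne_zero _ hu)).mp h
  have hTe : ∀ x, 0 < x → x < ε → ∀ t, T t x = ∑' a : ℤ, e (a, t - a) * (x : ℂ) ^ a := by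
    intro x hx hxε t
    have := laurentSeries_coeff_unique (a := fun k => T (-k) x)
      (b := fun k => ∑' a : ℤ, e (a, -k - a) * (x : ℂ) ^ a) (M := -L) ?_ ?_ hε ?_
    · simpa using congrFun this (-t)
    · intro k hk
      refine (hT (-k) x hx hxε).unique ?_
      convert hasSum_zero with a
      rw [vanish c hc _ (Or.inr (by simp only; omega)), zero_mul]
    · intro k hk
      refine (tsum_congr fun a => ?_).trans tsum_zero
      rw [vanish e he _ (Or.inr (by simp only; omega)), zero_mul]
    · intro u hu huε
      refine ⟨K x u, ?_, ?_⟩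
      · have := (Equiv.neg ℤ).hasSum_iff.mpr (hK x u hx hxε hu huε)
        simpa [Function.comp_def] using this
      · have h := (hdiag x u hx hxε hu huε).prod_fiberwise
          fun t => (hsum x hx hxε t).hasSum.mul_right ((u : ℂ) ^ (-t))
        have := (Equiv.neg ℤ).hasSum_iff.mpr h
        simpa [Function.comp_def] using this
  funext p
  have := laurentSeries_coeff_unique (a := fun a => c (a, p.1 + p.2 - a))
      (b := fun a => e (a, p.1 + p.2 - a)) (M := M)
      (fun k hk => vanish c hc _ (Or.inl hk)) (fun k hk => vanish e he _ (Or.inl hk)) hε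
      fun x hx hxε => ⟨_, hT _ x hx hxε, by
        rw [hTe x hx hxε]; exact (hsum x hx hxε _).hasSum⟩
  simpa using congrFun this p.1

lemma hasSum_mul_fiberwise {G : Type*} [Add G] {f g : G → ℂ} {s t : ℂ} (hf : HasSum f s)
    (hg : HasSum g t) :
    HasSum (fun r : G => ∑' q : {q : G × G // q.1 + q.2 = r}, f q.1.1 * g q.1.2) (s * t) := by
  have hmul := hf.mul hg (summable_mul_of_summable_norm hf.summable.norm hg.summable.norm)
  have hfib := (Equiv.sigmaFiberEquiv fun q : G × G => q.1 + q.2).hasSum_iff.mpr hmul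
  exact hfib.sigma fun r => (hfib.summable.sigma_factor r).hasSum

/-- The pairs `(X, Z)` with `X ≠ 0` and `‖X‖ + ‖ζ i‖ < ‖Z‖` for every `i`. -/
def expansionRegion {ι : Type*} (ζ : ι → ℂ) : Set (ℂ × ℂ) :=
  {p | p.1 ≠ 0 ∧ ∀ i, ‖p.1‖ + ‖ζ i‖ < ‖p.2‖}

/-- The support condition on the coefficients of an expansion in powers of `X` and `Z`: the
exponent of `X` is bounded below, the total degree is bounded above, and in the absence of
points `ζ i` no negative powers of `Z` occur. -/
def IsExpansionSupport (ι : Type*) (g : ℤ × ℤ → ℂ) : Prop :=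
  (∃ M L : ℤ, ∀ p, g p ≠ 0 → M ≤ p.1 ∧ p.1 + p.2 ≤ L) ∧ (IsEmpty ι → ∀ p, g p ≠ 0 → 0 ≤ p.2)

/-- `F` is the sum of the Laurent series in `X` and `Z` with coefficients `g`. -/
def IsExpansion {ι : Type*} {ζ : ι → ℂ} (g : ℤ × ℤ → ℂ) (F : expansionRegion ζ → ℂ) : Prop :=
  IsExpansionSupport ι g ∧
    ∀ ω, HasSum (fun p : ℤ × ℤ => g p * (ω.1.1 ^ p.1 * ω.1.2 ^ p.2)) (F ω)

section Expansion

variable {ι : Type*} {ζ : ι → ℂ}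

lemma isExpansion_monomial (c : ℂ) (a b : ℤ) (hb : IsEmpty ι → 0 ≤ b) :
    IsExpansion (Pi.single (a, b) c)
      (fun ω : expansionRegion ζ => c * (ω.1.1 ^ a * ω.1.2 ^ b)) := by
  have hs : ∀ p : ℤ × ℤ, (Pi.single (a, b) c : ℤ × ℤ → ℂ) p ≠ 0 → p = (a, b) := by
    intro p hp
    by_contra h
    exact hp (by simp [Pi.single_eq_of_ne h])
  refine ⟨⟨⟨a, a + b, fun p hp => ?_⟩, fun he p hp => ?_⟩, fun ω => ?_⟩
  · rw [hs p hp]; simp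
  · rw [hs p hp]; exact hb he
  · convert hasSum_single (a, b) fun p hp => ?_ using 1
    · simp
    · rw [Pi.single_eq_of_ne hp, zero_mul]

lemma IsExpansion.add {g g' : ℤ × ℤ → ℂ} {F F' : expansionRegion ζ → ℂ}
    (h : IsExpansion g F) (h' : IsExpansion g' F') : IsExpansion (g + g') (F + F') := by
  obtain ⟨⟨⟨M, L, hg⟩, hgE⟩, hF⟩ := h
  obtain ⟨⟨⟨M', L', hg'⟩, hgE'⟩, hF'⟩ := h'
  have hne : ∀ p, (g + g') p ≠ 0 → g p ≠ 0 ∨ g' p ≠ 0 := by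
    intro p hp
    by_contra! h0
    exact hp (by simp [h0.1, h0.2])
  refine ⟨⟨⟨min M M', max L L', fun p hp => ?_⟩, fun he p hp => ?_⟩, fun ω => ?_⟩
  · rcases hne p hp with h0 | h0
    · have := hg p h0; omega
    · have := hg' p h0; omega
  · rcases hne p hp with h0 | h0
    · exact hgE he p h0
    · exact hgE' he p h0
  · simpa [add_mul] using (hF ω).add (hF' ω)

lemma IsExpansion.mul {g g' : ℤ × ℤ → ℂ} {F F' : expansionRegion ζ → ℂ}
    (h : IsExpansion g F) (h' : IsExpansion g' F') :
    IsExpansion (fun r => ∑' q : {q : (ℤ × ℤ) × (ℤ × ℤ) // q.1 + q.2 = r}, g q.1.1 * g' q.1.2)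
      (F * F') := by
  obtain ⟨⟨⟨M, L, hg⟩, hgE⟩, hF⟩ := h
  obtain ⟨⟨⟨M', L', hg'⟩, hgE'⟩, hF'⟩ := h'
  have hne : ∀ r : ℤ × ℤ,
      (∑' q : {q : (ℤ × ℤ) × (ℤ × ℤ) // q.1 + q.2 = r}, g q.1.1 * g' q.1.2) ≠ 0 →
      ∃ p p', p + p' = r ∧ g p ≠ 0 ∧ g' p' ≠ 0 := by
    intro r hr
    by_contra! h0
    refine hr ((tsum_congr fun q => ?_).trans tsum_zero)
    by_cases hq : g q.1.1 = 0
    · rw [hq, zero_mul]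
    · rw [h0 _ _ q.2 hq, mul_zero]
  refine ⟨⟨⟨M + M', L + L', fun r hr => ?_⟩, fun he r hr => ?_⟩, fun ω => ?_⟩
  · obtain ⟨p, p', rfl, h1, h2⟩ := hne r hr
    have := hg p h1
    have := hg' p' h2
    simp only [Prod.fst_add, Prod.snd_add]
    omega
  · obtain ⟨p, p', rfl, h1, h2⟩ := hne r hr
    exact add_nonneg (hgE he p h1) (hgE' he p' h2)
  · have hterm : ∀ r : ℤ × ℤ, ∀ q : {q : (ℤ × ℤ) × (ℤ × ℤ) // q.1 + q.2 = r},
        g q.1.1 * (ω.1.1 ^ q.1.1.1 * ω.1.2 ^ q.1.1.2) *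
          (g' q.1.2 * (ω.1.1 ^ q.1.2.1 * ω.1.2 ^ q.1.2.2)) =
        g q.1.1 * g' q.1.2 * (ω.1.1 ^ r.1 * ω.1.2 ^ r.2) := by
      rintro r ⟨⟨p, p'⟩, rfl⟩
      by_cases h1 : g p = 0
      · simp [h1]
      by_cases h2 : g' p' = 0
      · simp [h2]
      have hZ : ω.1.2 ^ (p.2 + p'.2) = ω.1.2 ^ p.2 * ω.1.2 ^ p'.2 := by
        by_cases he : IsEmpty ι
        · obtain ⟨m, hm⟩ := Int.eq_ofNat_of_zero_le (hgE he p h1)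
          obtain ⟨m', hm'⟩ := Int.eq_ofNat_of_zero_le (hgE' he p' h2)
          rw [hm, hm', ← Nat.cast_add]
          simp only [zpow_natCast, pow_add]
        · obtain ⟨i⟩ := not_isEmpty_iff.mp he
          refine zpow_add₀ (norm_pos_iff.mp (lt_of_le_of_lt ?_ (ω.2.2 i))) _ _
          positivity
      simp only [Prod.fst_add, Prod.snd_add, zpow_add₀ ω.2.1, hZ]
      ring
    refine (hasSum_mul_fiberwise (hF ω) (hF' ω)).congr_fun fun r => ?_
    rw [← tsum_mul_right]
    exact tsum_congr fun q => (hterm r q).symm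

end Expansion

lemma hasSum_choose_mul_pow_mul_pow {y w : ℂ} (h : ‖y‖ + ‖w‖ < 1) :
    HasSum (fun p : ℕ × ℕ => ((p.1 + p.2).choose p.1 : ℂ) * (y ^ p.1 * w ^ p.2))
      (1 - (y + w))⁻¹ := by
  have key : ∀ (n : ℕ), ∑ p ∈ Finset.HasAntidiagonal.antidiagonal n,
      ‖((p.1 + p.2).choose p.1 : ℂ) * (y ^ p.1 * w ^ p.2)‖ = (‖y‖ + ‖w‖) ^ n := by
    intro n
    rw [(Commute.all _ _).add_pow']
    refine Finset.sum_congr rfl fun p hp => ?_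
    rw [Finset.HasAntidiagonal.mem_antidiagonal.mp hp]
    simp
  have key' : ∀ (n : ℕ), ∑ p ∈ Finset.HasAntidiagonal.antidiagonal n,
      ((p.1 + p.2).choose p.1 : ℂ) * (y ^ p.1 * w ^ p.2) = (y + w) ^ n := by
    intro n
    rw [(Commute.all _ _).add_pow']
    refine Finset.sum_congr rfl fun p hp => ?_
    rw [Finset.HasAntidiagonal.mem_antidiagonal.mp hp]
    simp
  have hs : Summable fun p : ℕ × ℕ => ‖((p.1 + p.2).choose p.1 : ℂ) * (y ^ p.1 * w ^ p.2)‖ := by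
    rw [← Finset.HasAntidiagonal.sigmaAntidiagonalEquivProd.summable_iff, summable_sigma_of_nonneg]
    · refine ⟨fun n => (hasSum_fintype _).summable, ?_⟩
      refine (summable_geometric_of_lt_one (by positivity) h).congr fun n => ?_
      rw [← key n, tsum_fintype]
      exact (Finset.sum_coe_sort (Finset.HasAntidiagonal.antidiagonal n)
        fun p : ℕ × ℕ => ‖((p.1 + p.2).choose p.1 : ℂ) * (y ^ p.1 * w ^ p.2)‖).symm
    · exact fun p => norm_nonneg _
  have h1 := (Finset.HasAntidiagonal.sigmaAntidiagonalEquivProd (A := ℕ)).hasSum_iff.mpr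
    hs.of_norm.hasSum
  have h2 := h1.sigma fun n => hasSum_fintype _
  have h3 : HasSum (fun n => (y + w) ^ n) (1 - (y + w))⁻¹ :=
    hasSum_geometric_of_norm_lt_one (lt_of_le_of_lt (norm_add_le _ _) h)
  have h4 := h2.unique (h3.congr_fun fun n => ?_)
  · rw [← h4]; exact hs.of_norm.hasSum
  · rw [← key' n]
    exact Finset.sum_coe_sort (Finset.HasAntidiagonal.antidiagonal n)
      fun p : ℕ × ℕ => ((p.1 + p.2).choose p.1 : ℂ) * (y ^ p.1 * w ^ p.2)

section Expansion

variable {ι : Type*} {ζ : ι → ℂ}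

lemma isExpansion_inv_linear (i : ι) {α : ℂ} (hα : ‖α‖ ≤ 1) :
    ∃ g, IsExpansion g (fun ω : expansionRegion ζ => (ω.1.2 + α * ω.1.1 - ζ i)⁻¹) := by
  let m : ℕ × ℕ → ℤ × ℤ := fun p => (p.1, -1 - p.1 - p.2)
  have hm : Function.Injective m := by
    rintro ⟨j, l⟩ ⟨j', l'⟩ h
    simp only [m, Prod.mk.injEq] at h ⊢
    omega
  let g₀ : ℕ × ℕ → ℂ := fun p => ((p.1 + p.2).choose p.1 : ℂ) * ((-α) ^ p.1 * ζ i ^ p.2)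
  have hrange : ∀ p, Function.extend m g₀ 0 p ≠ 0 → p ∈ Set.range m := by
    intro p hp
    by_contra h
    exact hp (by rw [Function.extend_apply' _ _ _ (by simpa using h)]; rfl)
  refine ⟨Function.extend m g₀ 0, ⟨⟨0, -1, fun p hp => ?_⟩, fun he => (he.false i).elim⟩,
    fun ω => ?_⟩
  · obtain ⟨q, rfl⟩ := hrange p hp
    simp only [m]
    omega
  · have hZ : ω.1.2 ≠ 0 := by
      refine norm_pos_iff.mp (lt_of_le_of_lt ?_ (ω.2.2 i))
      positivity
    have hZ' : 0 < ‖ω.1.2‖ := norm_pos_iff.mpr hZ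
    have hlt : ‖-α * (ω.1.1 / ω.1.2)‖ + ‖ζ i / ω.1.2‖ < 1 := by
      rw [norm_mul, norm_neg, norm_div, norm_div]
      have h1 : ‖α‖ * (‖ω.1.1‖ / ‖ω.1.2‖) ≤ ‖ω.1.1‖ / ‖ω.1.2‖ :=
        mul_le_of_le_one_left (by positivity) hα
      have h2 : ‖ω.1.1‖ / ‖ω.1.2‖ + ‖ζ i‖ / ‖ω.1.2‖ < 1 := by
        rw [← add_div, div_lt_one hZ']
        exact ω.2.2 i
      linarith
    have h := (hasSum_choose_mul_pow_mul_pow hlt).mul_right ω.1.2⁻¹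
    rw [← mul_inv, show (1 - (-α * (ω.1.1 / ω.1.2) + ζ i / ω.1.2)) * ω.1.2
      = ω.1.2 + α * ω.1.1 - ζ i by field_simp; ring] at h
    refine (Function.Injective.hasSum_iff hm fun p hp => ?_).mp (h.congr_fun fun p => ?_)
    · by_contra h0
      exact hp (hrange p (left_ne_zero_of_mul h0))
    · simp only [Function.comp_apply, hm.extend_apply, g₀, m, mul_pow, div_pow]
      rw [show (-1 - (p.1 : ℤ) - (p.2 : ℤ)) = -((p.1 + p.2 + 1 : ℕ) : ℤ) by push_cast; ring,
        zpow_neg, zpow_natCast, zpow_natCast, pow_add, pow_add]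
      field_simp

variable (ζ) in
/-- The algebra of functions on `expansionRegion ζ` that are sums of Laurent series in `X`
and `Z`. -/
def expansionAlgebra : Subalgebra ℂ (expansionRegion ζ → ℂ) where
  carrier := {F | ∃ g, IsExpansion g F}
  add_mem' := by
    rintro F F' ⟨g, h⟩ ⟨g', h'⟩
    exact ⟨_, h.add h'⟩
  mul_mem' := by
    rintro F F' ⟨g, h⟩ ⟨g', h'⟩
    exact ⟨_, h.mul h'⟩
  algebraMap_mem' := by
    intro c
    refine ⟨Pi.single (0, 0) c, ?_⟩
    convert isExpansion_monomial (ζ := ζ) c 0 0 (fun _ => le_rfl) using 1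
    funext ω
    simp

/-- The tuple `(Z + X, Z, ζ)` as functions of `(X, Z)`. -/
def shiftedPoint {n : ℕ} (ζ : Fin n → ℂ) (p : ℂ × ℂ) : Fin (n + 2) → ℂ :=
  Fin.cons (p.2 + p.1) (Fin.cons p.2 ζ)

lemma const_mem_expansionAlgebra (c : ℂ) : (fun _ => c) ∈ expansionAlgebra ζ :=
  (expansionAlgebra ζ).algebraMap_mem c

lemma monomial_mem_expansionAlgebra (a b : ℤ) (hb : IsEmpty ι → 0 ≤ b) :
    (fun ω : expansionRegion ζ => ω.1.1 ^ a * ω.1.2 ^ b) ∈ expansionAlgebra ζ :=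
  ⟨_, by simpa using isExpansion_monomial (ζ := ζ) 1 a b hb⟩

lemma shiftedPoint_mem {n : ℕ} (ζ : Fin n → ℂ) (i : Fin (n + 2)) :
    (fun ω : expansionRegion ζ => shiftedPoint ζ ω.1 i) ∈ expansionAlgebra ζ := by
  have hX : (fun ω : expansionRegion ζ => ω.1.1) ∈ expansionAlgebra ζ := by
    simpa using monomial_mem_expansionAlgebra (ζ := ζ) 1 0 fun _ => le_rfl
  have hZ : (fun ω : expansionRegion ζ => ω.1.2) ∈ expansionAlgebra ζ := by
    simpa using monomial_mem_expansionAlgebra (ζ := ζ) 0 1 fun _ => zero_le_one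
  refine Fin.cases ?_ (fun i => Fin.cases ?_ (fun i => ?_) i) i
  · exact add_mem hZ hX
  · exact hZ
  · exact const_mem_expansionAlgebra (ζ i)

lemma inv_sub_mem {n : ℕ} (ζ : Fin n → ℂ) (i j : Fin (n + 2)) (hij : i < j) :
    (fun ω : expansionRegion ζ => (shiftedPoint ζ ω.1 i - shiftedPoint ζ ω.1 j)⁻¹)
      ∈ expansionAlgebra ζ := by
  induction i using Fin.cases with
  | zero =>
    induction j using Fin.cases with
    | zero => exact (lt_irrefl _ hij).elim
    | succ j =>
      induction j using Fin.cases with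
      | zero =>
        simpa [shiftedPoint] using
          monomial_mem_expansionAlgebra (ζ := ζ) (-1) 0 fun _ => le_rfl
      | succ j =>
        simpa [shiftedPoint, expansionAlgebra] using
          isExpansion_inv_linear (ζ := ζ) j (α := 1) (by simp)
  | succ i =>
    induction j using Fin.cases with
    | zero => exact (not_lt_bot hij).elim
    | succ j =>
      induction i using Fin.cases with
      | zero =>
        induction j using Fin.cases with
        | zero => exact (lt_irrefl _ hij).elim
        | succ j =>
          simpa [shiftedPoint, expansionAlgebra] using
            isExpansion_inv_linear (ζ := ζ) j (α := 0) (by simp)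
      | succ i =>
        induction j using Fin.cases with
        | zero => simp [Fin.lt_def] at hij
        | succ j =>
          simpa [shiftedPoint] using const_mem_expansionAlgebra (ζ := ζ) (ζ i - ζ j)⁻¹

lemma exists_isExpansion_eval {n : ℕ} (ζ : Fin n → ℂ) (R : DiagRatFn (Fin (n + 2))) :
    ∃ g, IsExpansion g (fun ω : expansionRegion ζ => R.eval (shiftedPoint ζ ω.1)) := by
  change _ ∈ expansionAlgebra ζ
  have hnum : (fun ω : expansionRegion ζ => MvPolynomial.eval (shiftedPoint ζ ω.1) R.num)
      ∈ expansionAlgebra ζ := by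
    induction R.num using MvPolynomial.induction_on with
    | C c => simpa using const_mem_expansionAlgebra (ζ := ζ) c
    | add p q hp hq =>
      simp only [map_add]
      exact add_mem hp hq
    | mul_X p i hp =>
      simp only [map_mul, MvPolynomial.eval_X]
      exact mul_mem hp (shiftedPoint_mem ζ i)
  have hden : (∏ q ∈ Finset.univ.offDiag, (fun ω : expansionRegion ζ =>
      (shiftedPoint ζ ω.1 q.1 - shiftedPoint ζ ω.1 q.2)⁻¹) ^ R.b q.1 q.2)
      ∈ expansionAlgebra ζ := by
    refine prod_mem fun q hq => pow_mem ?_ _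
    rcases lt_or_gt_of_ne (Finset.mem_offDiag.mp hq).2.2 with h | h
    · exact inv_sub_mem ζ _ _ h
    · convert neg_mem (inv_sub_mem ζ _ _ h) using 1
      funext ω
      simp only [Pi.neg_apply, ← inv_neg, neg_sub]
  convert mul_mem hnum hden using 1
  funext ω
  simp [DiagRatFn.eval, div_eq_mul_inv, Finset.prod_inv_distrib]

end Expansion

section Homogeneous

variable {V : Type*} [AddCommGroup V] [Module ℂ V]
variable {W : Type*} [AddCommGroup W] [Module ℂ W] {A : MOSVA V}

lemma CGrading.proj_proj_of_ne (G : CGrading W) {m n : ℂ} (h : m ≠ n) (w : W) :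
    G.proj m (G.proj n w) = 0 := by
  simpa [h] using LinearMap.congr_fun (G.proj_comp m n) w

lemma CGrading.proj_proj_self (G : CGrading W) (n : ℂ) (w : W) :
    G.proj n (G.proj n w) = G.proj n w := by
  simpa using LinearMap.congr_fun (G.proj_comp n n) w

lemma ZGrading.proj_proj_of_ne (G : ZGrading W) {m n : ℤ} (h : m ≠ n) (w : W) :
    G.proj m (G.proj n w) = 0 := by
  simpa [h] using LinearMap.congr_fun (G.proj_comp m n) w

lemma ZGrading.proj_proj_self (G : ZGrading W) (n : ℤ) (w : W) :
    G.proj n (G.proj n w) = G.proj n w := by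
  simpa using LinearMap.congr_fun (G.proj_comp n n) w

lemma CGrading.proj_eq_zero_of_ne (G : CGrading W) {m n : ℂ} {w : W} (hw : G.proj n w = w)
    (h : m ≠ n) : G.proj m w = 0 := by
  rw [← hw, G.proj_proj_of_ne h]

lemma ZGrading.proj_eq_zero_of_ne (G : ZGrading W) {m n : ℤ} {w : W} (hw : G.proj n w = w)
    (h : m ≠ n) : G.proj m w = 0 := by
  rw [← hw, G.proj_proj_of_ne h]

lemma CGrading.d_of_proj_eq (G : CGrading W) {n : ℂ} {w : W} (hw : G.proj n w = w) :
    G.d w = n • w := by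
  rw [CGrading.d, finsum_eq_single _ n fun m hm => by rw [G.proj_eq_zero_of_ne hw hm, smul_zero],
    hw]

lemma ZGrading.d_of_proj_eq (G : ZGrading W) {n : ℤ} {w : W} (hw : G.proj n w = w) :
    G.d w = (n : ℂ) • w := by
  rw [ZGrading.d, finsum_eq_single _ n fun m hm => by rw [G.proj_eq_zero_of_ne hw hm, smul_zero],
    hw]

lemma CGrading.proj_d (G : CGrading W) (m : ℂ) (w : W) : G.proj m (G.d w) = m • G.proj m w := by
  have hs : (Function.support fun n : ℂ => n • G.proj n w).Finite :=
    (G.proj_finite w).subset fun n hn h0 => hn (by simp only [h0, smul_zero])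
  have h := AddMonoidHom.map_finsum (G.proj m).toAddMonoidHom hs
  simp only [LinearMap.toAddMonoidHom_coe] at h
  rw [CGrading.d, h, finsum_eq_single _ m fun n hn => by
    rw [map_smul, G.proj_proj_of_ne hn.symm, smul_zero], map_smul, G.proj_proj_self]

lemma ZGrading.proj_d (G : ZGrading W) (m : ℤ) (w : W) :
    G.proj m (G.d w) = (m : ℂ) • G.proj m w := by
  have hs : (Function.support fun n : ℤ => (n : ℂ) • G.proj n w).Finite :=
    (G.proj_finite w).subset fun n hn h0 => hn (by simp only [h0, smul_zero])
  have h := AddMonoidHom.map_finsum (G.proj m).toAddMonoidHom hs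
  simp only [LinearMap.toAddMonoidHom_coe] at h
  rw [ZGrading.d, h, finsum_eq_single _ m fun n hn => by
    rw [map_smul, G.proj_proj_of_ne hn.symm, smul_zero], map_smul, G.proj_proj_self]

lemma CGrading.proj_eq_of_d (G : CGrading W) {c : ℂ} {w : W} (h : G.d w = c • w) :
    G.proj c w = w := by
  conv_rhs => rw [← G.proj_sum w]
  refine (finsum_eq_single (fun m => G.proj m w) c fun m hm => ?_).symm
  have h1 : (m - c) • G.proj m w = 0 := by
    rw [sub_smul, ← G.proj_d, h, map_smul, sub_self]
  exact (smul_eq_zero.mp h1).resolve_left (sub_ne_zero.mpr hm)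

lemma ZGrading.proj_eq_of_d (G : ZGrading W) {c : ℤ} {w : W} (h : G.d w = (c : ℂ) • w) :
    G.proj c w = w := by
  conv_rhs => rw [← G.proj_sum w]
  refine (finsum_eq_single (fun m => G.proj m w) c fun m hm => ?_).symm
  have h1 : ((m : ℂ) - c) • G.proj m w = 0 := by
    rw [sub_smul, ← G.proj_d, h, map_smul, sub_self]
  exact (smul_eq_zero.mp h1).resolve_left (sub_ne_zero.mpr (by exact_mod_cast hm))

lemma ZGrading.exists_eq_sum (G : ZGrading W) (w : W) :
    ∃ S : Finset ℤ, w = ∑ p ∈ S, G.proj p w :=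
  ⟨(G.proj_finite w).toFinset, by
    conv_lhs => rw [← G.proj_sum w]
    exact finsum_eq_sum_of_support_subset _ (by simp)⟩

lemma MOSVA.proj_Y (A : MOSVA V) {p q : ℤ} {u v : V} (hu : A.gr.proj p u = u)
    (hv : A.gr.proj q v = v) (k : ℤ) : A.gr.proj (p + q - k - 1) (A.Y u v k) = A.Y u v k := by
  refine A.gr.proj_eq_of_d ?_
  rw [A.d_comm, A.gr.d_of_proj_eq hu, A.gr.d_of_proj_eq hv]
  simp only [map_smul, LinearMap.smul_apply, Pi.smul_apply, ← add_smul]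
  congr 1
  push_cast
  ring

lemma Bimod.proj_YL (B : Bimod A W) {p : ℤ} {n : ℂ} {u : V} {w : W} (hu : A.gr.proj p u = u)
    (hw : B.gr.proj n w = w) (k : ℤ) :
    B.gr.proj (n + p - k - 1) (B.YL u w k) = B.YL u w k := by
  refine B.gr.proj_eq_of_d ?_
  rw [B.d_commL, A.gr.d_of_proj_eq hu, B.gr.d_of_proj_eq hw]
  simp only [map_smul, LinearMap.smul_apply, Pi.smul_apply, ← add_smul]
  congr 1
  ring

lemma Bimod.ext_YL_sum (B : Bimod A W) {I : Type*} (s : Finset I) (v : I → V) (wt : I → ℤ)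
    (hv : ∀ i, A.gr.proj (wt i) (v i) = v i) (k : ℤ) (F : B.gr.Comp) (m : ℂ) :
    (B.gr.ext (fun x => B.YL (∑ i ∈ s, v i) x k) F).1 m =
      ∑ i ∈ s, B.YL (v i) (F.1 (m + k + 1 - wt i)) k := by
  have hterm : ∀ n i, n ≠ m + k + 1 - wt i → B.gr.proj m (B.YL (v i) (F.1 n) k) = 0 := by
    intro n i hn
    refine B.gr.proj_eq_zero_of_ne (B.proj_YL (hv i) (F.2 n) k) fun h => hn ?_
    rw [h]; ring
  change ∑ᶠ n : ℂ, B.gr.proj m (B.YL (∑ i ∈ s, v i) (F.1 n) k) = _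
  simp only [map_sum, LinearMap.sum_apply, Finset.sum_apply]
  rw [finsum_sum_comm]
  · refine Finset.sum_congr rfl fun i _ => ?_
    rw [finsum_eq_single _ _ fun n hn => hterm n i hn]
    have h := B.proj_YL (hv i) (F.2 (m + k + 1 - wt i)) k
    rwa [show m + k + 1 - wt i + wt i - k - 1 = m by ring] at h
  · intro i _
    exact (Set.finite_singleton (m + k + 1 - (wt i : ℂ))).subset fun n hn => by
      by_contra h
      exact hn (hterm n i h)

lemma CGrading.exists_pair_eq_sum (G : CGrading W) {φ : W →ₗ[ℂ] ℂ}
    (hφ : InGradedDual G.proj φ) :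
    ∃ S : Finset ℂ, ∀ F : G.Comp, G.pair φ F = ∑ m ∈ S, φ (F.1 m) := by
  have hφ' : (Function.support fun n => φ ∘ₗ G.proj n).Finite := hφ
  refine ⟨hφ'.toFinset, fun F => finsum_eq_sum_of_support_subset _ fun n hn => ?_⟩
  rw [Finset.mem_coe, Set.Finite.mem_toFinset]
  intro h
  refine hn ?_
  change φ (F.1 n) = 0
  rw [← F.2 n]
  exact LinearMap.congr_fun h (F.1 n)

lemma CGrading.inGradedDual_comp_proj (G : CGrading W) (φ : W →ₗ[ℂ] ℂ) (m : ℂ) :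
    InGradedDual G.proj (φ ∘ₗ G.proj m) := by
  refine (Set.finite_singleton m).subset fun n hn => ?_
  by_contra h
  refine hn (LinearMap.ext fun w => ?_)
  simp [G.proj_proj_of_ne (Ne.symm h)]

lemma hasSum_diagonal {f : ℤ × ℤ → ℂ} {s : ℤ} {T : ℂ} (hf : ∀ k, k.1 + k.2 ≠ s → f k = 0)
    (h : HasSum f T) : HasSum (fun k => f (k, s - k)) T := by
  refine (Function.Injective.hasSum_iff (g := fun k : ℤ => (k, s - k)) ?_ fun k hk => ?_).mpr h
  · exact fun k l hkl => (Prod.mk.inj hkl).1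
  · refine hf k fun hs => hk ⟨k.1, ?_⟩
    ext
    · rfl
    · simp only; omega

/-- Products and iterates of homogeneous components agree degree by degree. -/
lemma Bimod.exists_hasSum_homogeneous (B : Bimod A W) (φ : W →ₗ[ℂ] ℂ) {p q : ℤ} {u₁ u₂ : V}
    (hu₁ : A.gr.proj p u₁ = u₁) (hu₂ : A.gr.proj q u₂ = u₂) (F : B.gr.Comp) (m : ℂ) (s : ℤ)
    {x : ℝ} (hx : 0 < x) (hx1 : x < 1) :
    ∃ T, HasSum (fun k : ℤ => φ (B.YL u₁ (B.YL u₂ (F.1 (m + s + 2 - p - q)) (s - k)) k) *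
          (1 + x : ℂ) ^ (-k - 1)) T ∧
      HasSum (fun k : ℤ => φ (B.YL (A.Y u₁ u₂ k) (F.1 (m + s + 2 - p - q)) (s - k)) *
          (x : ℂ) ^ (-k - 1)) T := by
  set w := F.1 (m + s + 2 - p - q) with hw
  have hwp : B.gr.proj (m + s + 2 - p - q) w = w := F.2 _
  obtain ⟨R, hR1, hR2⟩ := B.associativityL u₁ u₂ w _ (B.gr.inGradedDual_comp_proj φ m)
  have hprod : ∀ k₁ k₂ : ℤ, B.gr.proj (m + (s - (k₁ + k₂))) (B.YL u₁ (B.YL u₂ w k₂) k₁) =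
      B.YL u₁ (B.YL u₂ w k₂) k₁ := by
    intro k₁ k₂
    rw [show m + ((s : ℂ) - (k₁ + k₂)) = m + s + 2 - p - q + q - k₂ - 1 + p - k₁ - 1 by ring]
    exact B.proj_YL hu₁ (B.proj_YL hu₂ hwp k₂) k₁
  have hiter : ∀ k₁ k₂ : ℤ, B.gr.proj (m + (s - (k₁ + k₂))) (B.YL (A.Y u₁ u₂ k₁) w k₂) =
      B.YL (A.Y u₁ u₂ k₁) w k₂ := by
    intro k₁ k₂
    rw [show m + ((s : ℂ) - (k₁ + k₂)) = m + s + 2 - p - q + (p + q - k₁ - 1 : ℤ) - k₂ - 1 by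
      push_cast; ring]
    exact B.proj_YL (A.proj_Y hu₁ hu₂ k₁) hwp k₂
  have hoff : ∀ {k₁ k₂ : ℤ}, k₁ + k₂ ≠ s → m ≠ m + (s - (k₁ + k₂)) := by
    intro k₁ k₂ hk h
    have h0 : (s : ℂ) - (k₁ + k₂) = 0 := by linear_combination -h
    exact hk (by exact_mod_cast (sub_eq_zero.mp h0).symm)
  have hdiag : ∀ k : ℤ, m + ((s : ℂ) - (k + (s - k : ℤ))) = m := by
    intro k; push_cast; ring
  have h1x : ‖(1 + x : ℂ)‖ = 1 + x := by
    rw [← Complex.ofReal_one, ← Complex.ofReal_add, Complex.norm_real,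
      Real.norm_of_nonneg (by linarith)]
  have hsub : (1 + x : ℂ) - 1 = x := by ring
  have hxn : ‖(x : ℂ)‖ = x := by rw [Complex.norm_real, Real.norm_of_nonneg hx.le]
  have h1 := (hR1 (1 + x) 1 (by rw [h1x]; simpa using hx) (by simp)).2
  have h2 := (hR2 (1 + x) 1 (by rw [hsub, hxn]; simpa using hx1)
    (by rw [hsub, hxn]; exact hx)).2
  refine ⟨_, (hasSum_diagonal (s := s) (fun k hk => ?_) h1).congr_fun fun k => ?_,
    (hasSum_diagonal (s := s) (fun k hk => ?_) h2).congr_fun fun k => ?_⟩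
  · rw [LinearMap.comp_apply, B.gr.proj_eq_zero_of_ne (hprod k.1 k.2) (hoff hk)]
    simp
  · have h := hprod k (s - k)
    rw [hdiag] at h
    simp [h]
  · rw [LinearMap.comp_apply, B.gr.proj_eq_zero_of_ne (hiter k.1 k.2) (hoff hk)]
    simp
  · have h := hiter k (s - k)
    rw [hdiag] at h
    simp [h]

/-- The coefficients of the product and of the iterate of two left vertex operators applied to
an element of the completion: degree by degree they have a common sum, and the coefficients of
the iterate vanish in low degree and beyond the order of truncation. -/
lemma Bimod.exists_hasSum_diagonal (B : Bimod A W) (v₁ v₂ : V) {φ : W →ₗ[ℂ] ℂ}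
    (hφ : InGradedDual B.gr.proj φ) (F : B.gr.Comp) :
    (∀ (s : ℤ) (x : ℝ), 0 < x → x < 1 → ∃ T,
      HasSum (fun k : ℤ => B.gr.pair φ (B.gr.ext (fun x => B.YL v₁ x k)
          (B.gr.ext (fun x => B.YL v₂ x (s - k)) F)) * (1 + x : ℂ) ^ (-k - 1)) T ∧
      HasSum (fun k : ℤ => B.gr.pair φ (B.gr.ext (fun x => B.YL (A.Y v₁ v₂ k) x (s - k)) F) *
          (x : ℂ) ^ (-k - 1)) T) ∧
    ∃ S N : ℤ, ∀ k₁ k₂ : ℤ, (k₁ + k₂ < S ∨ N ≤ k₂) →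
      B.gr.pair φ (B.gr.ext (fun x => B.YL (A.Y v₁ v₂ k₂) x k₁) F) = 0 := by
  obtain ⟨S₁, hS₁⟩ := A.gr.exists_eq_sum v₁
  obtain ⟨S₂, hS₂⟩ := A.gr.exists_eq_sum v₂
  obtain ⟨S₀, hS₀⟩ := B.gr.exists_pair_eq_sum hφ
  have hprod : ∀ k₁ k₂ s : ℤ, k₁ + k₂ = s →
      B.gr.pair φ (B.gr.ext (fun x => B.YL v₁ x k₁) (B.gr.ext (fun x => B.YL v₂ x k₂) F)) =
      ∑ i ∈ S₀ ×ˢ S₁ ×ˢ S₂, φ (B.YL (A.gr.proj i.2.1 v₁) (B.YL (A.gr.proj i.2.2 v₂)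
        (F.1 (i.1 + s + 2 - i.2.1 - i.2.2)) k₂) k₁) := by
    rintro k₁ k₂ s rfl
    rw [hS₀, Finset.sum_product]
    refine Finset.sum_congr rfl fun m _ => ?_
    conv_lhs => rw [hS₁, hS₂]
    rw [B.ext_YL_sum _ _ id fun p => A.gr.proj_proj_self p v₁, map_sum, Finset.sum_product]
    refine Finset.sum_congr rfl fun p _ => ?_
    rw [B.ext_YL_sum _ _ id fun p => A.gr.proj_proj_self p v₂]
    simp only [map_sum, Finset.sum_apply, id]
    refine Finset.sum_congr rfl fun q _ => ?_
    rw [show m + ((k₁ + k₂ : ℤ) : ℂ) + 2 - p - q = m + k₁ + 1 - p + k₂ + 1 - q by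
      push_cast; ring]
  have hiter : ∀ k₁ k₂ s : ℤ, k₁ + k₂ = s →
      B.gr.pair φ (B.gr.ext (fun x => B.YL (A.Y v₁ v₂ k₂) x k₁) F) =
      ∑ i ∈ S₀ ×ˢ S₁ ×ˢ S₂, φ (B.YL (A.Y (A.gr.proj i.2.1 v₁) (A.gr.proj i.2.2 v₂) k₂)
        (F.1 (i.1 + s + 2 - i.2.1 - i.2.2)) k₁) := by
    rintro k₁ k₂ s rfl
    have hY : A.Y v₁ v₂ k₂ = ∑ j ∈ S₁ ×ˢ S₂, A.Y (A.gr.proj j.1 v₁) (A.gr.proj j.2 v₂) k₂ := by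
      conv_lhs => rw [hS₁, hS₂]
      simp only [map_sum, LinearMap.sum_apply, Finset.sum_apply, Finset.sum_product]
      exact Finset.sum_comm
    rw [hS₀, Finset.sum_product, hY]
    refine Finset.sum_congr rfl fun m _ => ?_
    rw [B.ext_YL_sum (S₁ ×ˢ S₂) (fun j => A.Y (A.gr.proj j.1 v₁) (A.gr.proj j.2 v₂) k₂)
      (fun j => j.1 + j.2 - k₂ - 1) fun j =>
      A.proj_Y (A.gr.proj_proj_self _ _) (A.gr.proj_proj_self _ _) k₂, map_sum]
    refine Finset.sum_congr rfl fun j _ => ?_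
    dsimp only
    rw [show m + ((k₁ + k₂ : ℤ) : ℂ) + 2 - j.1 - j.2 =
      m + k₁ + 1 - (j.1 + j.2 - k₂ - 1 : ℤ) by push_cast; ring]
  refine ⟨fun s x hx hx1 => ?_, ?_⟩
  · choose T hT₁ hT₂ using fun i : ℂ × ℤ × ℤ => B.exists_hasSum_homogeneous φ
      (A.gr.proj_proj_self i.2.1 v₁) (A.gr.proj_proj_self i.2.2 v₂) F i.1 s hx hx1
    refine ⟨∑ i ∈ S₀ ×ˢ S₁ ×ˢ S₂, T i, (hasSum_sum fun i _ => hT₁ i).congr_fun fun k => ?_,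
      (hasSum_sum fun i _ => hT₂ i).congr_fun fun k => ?_⟩
    · rw [hprod k (s - k) s (by ring), Finset.sum_mul]
    · rw [hiter (s - k) k s (by ring), Finset.sum_mul]
  · obtain ⟨b, hb⟩ := B.gr.lower_bound
    obtain ⟨N, hN⟩ := A.trunc v₁ v₂
    obtain ⟨S, hS⟩ := ((S₀ ×ˢ S₁ ×ˢ S₂).image
      fun i => ⌊b - i.1.re - 2 + i.2.1 + i.2.2⌋).bddBelow
    refine ⟨S, N, fun k₁ k₂ hk => ?_⟩
    rcases hk with hk | hk
    · rw [hiter k₁ k₂ _ rfl]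
      refine Finset.sum_eq_zero fun i hi => ?_
      have hi' := hS (Finset.mem_coe.mpr (Finset.mem_image_of_mem _ hi))
      have hlt := Int.lt_floor_iff.mp (lt_of_lt_of_le hk hi')
      rw [← F.2, hb]
      · simp
      · simp only [Complex.sub_re, Complex.add_re, Complex.intCast_re, Complex.re_ofNat]
        linarith
    · rw [hN k₂ hk, hS₀]
      refine Finset.sum_eq_zero fun m _ => ?_
      have h := B.ext_YL_sum (∅ : Finset ℤ) (fun _ => 0) (fun _ => 0) (by simp) k₁ F m
      simp only [Finset.sum_empty] at h
      rw [h, map_zero]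

end Homogeneous

section Iterate

variable {V : Type*} [AddCommGroup V] [Module ℂ V]
variable {W : Type*} [AddCommGroup W] [Module ℂ W] {A : MOSVA V}

lemma conf_cons_cons {n : ℕ} {ζ : Fin n → ℂ} (hζ : Conf ζ) {z₁ z₂ : ℂ} (h : ‖z₂‖ < ‖z₁‖)
    (hz : ∀ i, ‖ζ i‖ < ‖z₂‖) : Conf (Fin.cons z₁ (Fin.cons z₂ ζ) : Fin (n + 2) → ℂ) := by
  have hinj : Function.Injective ζ := fun i j hij => by_contra fun hne => hζ i j hne hij
  have : Function.Injective (Fin.cons z₁ (Fin.cons z₂ ζ) : Fin (n + 2) → ℂ) := by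
    rw [Fin.cons_injective_iff, Fin.cons_injective_iff]
    refine ⟨?_, ?_, hinj⟩
    · rintro ⟨i, hi⟩
      induction i using Fin.cases with
      | zero => simp only [Fin.cons_zero] at hi; rw [hi] at h; exact lt_irrefl _ h
      | succ i =>
        simp only [Fin.cons_succ] at hi
        have := hz i
        rw [hi] at this
        exact lt_asymm h this
    · rintro ⟨i, hi⟩
      have := hz i
      rw [hi] at this
      exact lt_irrefl _ this
  exact fun i j hij h => hij (this h)

lemma Conf.of_cons_cons {n : ℕ} {ζ : Fin n → ℂ} {z₁ z₂ : ℂ}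
    (h : Conf (Fin.cons z₁ (Fin.cons z₂ ζ) : Fin (n + 2) → ℂ)) : Conf ζ ∧ z₁ ≠ z₂ := by
  refine ⟨fun i j hij => ?_, ?_⟩
  · simpa using h i.succ.succ j.succ.succ (by simpa using hij)
  · simpa using h 0 (Fin.succ 0) (by simp)

/-- If the product of two left vertex operators applied to an element of the completion
converges to a rational function without poles at the origin, then so does the iterate. -/
theorem Bimod.hasSum_iterate (B : Bimod A W) (v₁ v₂ : V) {φ : W →ₗ[ℂ] ℂ}
    (hφ : InGradedDual B.gr.proj φ) (F : B.gr.Comp) {n : ℕ} {ζ : Fin n → ℂ} (hζ : Conf ζ)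
    (R : DiagRatFn (Fin (n + 2)))
    (hR : ∀ z₁ z₂ : ℂ, Conf (Fin.cons z₁ (Fin.cons z₂ ζ) : Fin (n + 2) → ℂ) → ‖z₂‖ < ‖z₁‖ →
      (∀ i, ‖ζ i‖ < ‖z₂‖) →
      HasSum (fun k : ℤ × ℤ => B.gr.pair φ (B.gr.ext (fun x => B.YL v₁ x k.1)
          (B.gr.ext (fun x => B.YL v₂ x k.2) F)) * z₁ ^ (-k.1 - 1) * z₂ ^ (-k.2 - 1))
        (R.eval (Fin.cons z₁ (Fin.cons z₂ ζ))))
    {z₁ z₂ : ℂ} (h₁₂ : z₁ ≠ z₂) (hz : ∀ i, ‖z₁ - z₂‖ + ‖ζ i‖ < ‖z₂‖) :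
    HasSum (fun k : ℤ × ℤ => B.gr.pair φ (B.gr.ext (fun x => B.YL (A.Y v₁ v₂ k.2) x k.1) F)
        * (z₁ - z₂) ^ (-k.2 - 1) * z₂ ^ (-k.1 - 1))
      (R.eval (Fin.cons z₁ (Fin.cons z₂ ζ))) := by
  obtain ⟨g, ⟨⟨M, L, hg⟩, -⟩, hgR⟩ := exists_isExpansion_eval ζ R
  obtain ⟨hdiag, S, N, hSN⟩ := B.exists_hasSum_diagonal v₁ v₂ hφ F
  choose! T hT₁ hT₂ using hdiag
  set c : ℤ × ℤ → ℂ := fun p =>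
    B.gr.pair φ (B.gr.ext (fun x => B.YL (A.Y v₁ v₂ (-p.1 - 1)) x (-p.2 - 1)) F) with hc
  obtain ⟨ρ, hρ, hζρ⟩ : ∃ ρ : ℝ, 0 < ρ ∧ ∀ i, ‖ζ i‖ < ρ := by
    refine ⟨1 + ∑ i, ‖ζ i‖, by positivity, fun i => ?_⟩
    have := Finset.single_le_sum (f := fun i => ‖ζ i‖) (fun j _ => norm_nonneg _)
      (Finset.mem_univ i)
    linarith
  obtain ⟨ε, hε, hε2, hερ⟩ : ∃ ε : ℝ, 0 < ε ∧ ε ≤ 1 / 2 ∧ ε * ρ ≤ 1 / 2 := by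
    refine ⟨min (1 / 2) (1 / (2 * ρ)), by positivity, min_le_left _ _, ?_⟩
    calc min (1 / 2) (1 / (2 * ρ)) * ρ ≤ 1 / (2 * ρ) * ρ := by gcongr; exact min_le_right _ _
      _ = 1 / 2 := by field_simp
  have hζu : ∀ u : ℝ, 0 < u → u < ε → ∀ i, ‖ζ i‖ * u < 1 / 2 := by
    intro u hu huε i
    calc ‖ζ i‖ * u < ρ * u := by gcongr; exact hζρ i
      _ ≤ ρ * ε := by gcongr
      _ ≤ 1 / 2 := by linarith
  have hinv : ∀ u : ℝ, 0 < u → ‖((u : ℂ))⁻¹‖ = u⁻¹ := fun u hu => by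
    rw [norm_inv, Complex.norm_real, Real.norm_of_nonneg hu.le]
  have hcg : c = g := by
    refine doubleSeries_coeff_unique (M := min (-N) M) (L := max (-S - 2) L) (ε := ε)
      (T := fun t x => T (-t - 2) x)
      (K := fun x u => R.eval (shiftedPoint ζ ((x : ℂ) * (u : ℂ)⁻¹, (u : ℂ)⁻¹)))
      (fun p hp => ?_) (fun p hp => ?_) hε (fun t x hx hxε => ?_)
      (fun x u hx hxε hu huε => ?_) (fun x u hx hxε hu huε => ?_)
    · have h := not_imp_not.mpr (hSN (-p.2 - 1) (-p.1 - 1)) hp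
      push Not at h
      constructor
      · exact (min_le_left _ _).trans (by omega)
      · exact le_trans (by omega) (le_max_left _ _)
    · exact ⟨(min_le_right _ _).trans (hg p hp).1, (hg p hp).2.trans (le_max_right _ _)⟩
    · refine ((Equiv.subLeft (-1 : ℤ)).hasSum_iff.mp ?_)
      refine (hT₂ (-t - 2) x hx (by linarith)).congr_fun fun k => ?_
      simp only [Function.comp_apply, Equiv.subLeft_apply, hc]
      rw [show -(-1 - k) - 1 = k by ring, show -(t - (-1 - k)) - 1 = -t - 2 - k by ring,
        show -1 - k = -k - 1 by ring]
    · have hu0 : (u : ℂ) ≠ 0 := Complex.ofReal_ne_zero.mpr hu.ne'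
      have hn1 : ‖(1 + x : ℂ) * (u : ℂ)⁻¹‖ = (1 + x) * u⁻¹ := by
        rw [norm_mul, hinv u hu, ← Complex.ofReal_one, ← Complex.ofReal_add, Complex.norm_real,
          Real.norm_of_nonneg (by linarith)]
      have hlt : ‖(u : ℂ)⁻¹‖ < ‖(1 + x : ℂ) * (u : ℂ)⁻¹‖ := by
        rw [hn1, hinv u hu]
        have := inv_pos.mpr hu
        nlinarith
      have hlt' : ∀ i, ‖ζ i‖ < ‖(u : ℂ)⁻¹‖ := fun i => by
        rw [hinv u hu, inv_eq_one_div, lt_div_iff₀ hu]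
        linarith [hζu u hu huε i]
      have h := hR _ _ (conf_cons_cons hζ hlt hlt') hlt hlt'
      let E : ℤ × ℤ ≃ ℤ × ℤ :=
        { toFun := fun p => (p.2, -p.1 - 2 - p.2)
          invFun := fun k => (-k.1 - k.2 - 2, k.1)
          left_inv := fun p => by ext <;> simp only; ring
          right_inv := fun k => by ext <;> simp only; ring }
      have h' := (E.hasSum_iff.mpr h).prod_fiberwise
        (g := fun t => T (-t - 2) x * (u : ℂ) ^ (-t)) fun t => by
        refine ((hT₁ (-t - 2) x hx (by linarith)).mul_right ((u : ℂ) ^ (-t))).congr_fun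
          fun k => ?_
        simp only [Function.comp_apply, E, Equiv.coe_fn_mk]
        rw [mul_zpow, mul_assoc, mul_assoc, mul_assoc, inv_zpow', inv_zpow', ← zpow_add₀ hu0]
        congr 4
        ring
      convert h' using 3
      simp only [shiftedPoint]
      congr 1
      ring
    · have hω : ((x : ℂ) * (u : ℂ)⁻¹, (u : ℂ)⁻¹) ∈ expansionRegion ζ := by
        refine ⟨by simp [hx.ne', hu.ne'], fun i => ?_⟩
        simp only [norm_mul, hinv u hu, Complex.norm_real, Real.norm_of_nonneg hx.le]
        have := hζu u hu huε i
        rw [← div_eq_mul_inv, inv_eq_one_div, div_add' _ _ _ hu.ne']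
        gcongr
        linarith
      refine (hgR ⟨_, hω⟩).congr_fun fun p => ?_
      have hu0 : (u : ℂ) ≠ 0 := Complex.ofReal_ne_zero.mpr hu.ne'
      simp only
      rw [mul_zpow, mul_assoc ((x : ℂ) ^ p.1), ← zpow_add₀ (inv_ne_zero hu0), inv_zpow']
  have hω : (z₁ - z₂, z₂) ∈ expansionRegion ζ := ⟨sub_ne_zero.mpr h₁₂, hz⟩
  have h := hgR ⟨_, hω⟩
  simp only [shiftedPoint, add_sub_cancel] at h
  let E : ℤ × ℤ ≃ ℤ × ℤ := (Equiv.prodComm ℤ ℤ).trans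
    ((Equiv.subLeft (-1 : ℤ)).prodCongr (Equiv.subLeft (-1 : ℤ)))
  refine (E.hasSum_iff.mpr h).congr_fun fun k => ?_
  rw [← hcg]
  simp only [Function.comp_apply, E, hc, Equiv.trans_apply, Equiv.prodComm_apply, Prod.swap,
    Equiv.prodCongr_apply, Prod.map, Equiv.subLeft_apply]
  rw [show -(-1 - k.1) - 1 = k.1 by ring, show -(-1 - k.2) - 1 = k.2 by ring,
    show -1 - k.1 = -k.1 - 1 by ring, show -1 - k.2 = -k.2 - 1 by ring, mul_assoc]

end Iterate

/-- With the hypotheses of Statement 9, the product series and the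
iterate series agree wherever `|z₁| > |z₂| > |z₁ − z₂| + |z_i|` (both converge
absolutely to the value of the common `W̄`-valued rational function `h`), and
`E(Y_W^L(v₁,z₁)Y_W^L(v₂,z₂)f) = E(Y_W^L(Y_V(v₁,z₁−z₂)v₂,z₂)f)` as elements of
`W̃_{z₁,…,z_{n+2}}` (the iterate series converges to `h` on its whole region of
convergence). -/
theorem statement10 {V : Type*} [AddCommGroup V] [Module ℂ V]
    {W : Type*} [AddCommGroup W] [Module ℂ W]
    (A : MOSVA V) (B : Bimod A W) (hA : A.PoleOrder) (hB : B.PoleOrder)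
    (n : ℕ) (v₁ v₂ : V)
    (f : (Fin n → ℂ) → B.gr.Comp) (hfW : B.gr.WTilde f)
    (h : (Fin (n+2) → ℂ) → B.gr.Comp) (hhW : B.gr.WTilde h)
    (hconv : ∀ (z₁ z₂ : ℂ) (zt : Fin n → ℂ), Conf (Fin.cons z₁ (Fin.cons z₂ zt)) →
      ‖z₂‖ < ‖z₁‖ → (∀ i, ‖zt i‖ < ‖z₂‖) →
      ∀ φ : W →ₗ[ℂ] ℂ, InGradedDual B.gr.proj φ →
        AbsConvTo (fun k : ℤ × ℤ =>
            B.gr.pair φ (B.gr.ext (fun x => B.YL v₁ x k.1)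
                (B.gr.ext (fun x => B.YL v₂ x k.2) (f zt)))
              * z₁ ^ (-k.1 - 1) * z₂ ^ (-k.2 - 1))
          (B.gr.pair φ (h (Fin.cons z₁ (Fin.cons z₂ zt))))) :
    (∀ (z₁ z₂ : ℂ) (zt : Fin n → ℂ), Conf (Fin.cons z₁ (Fin.cons z₂ zt)) →
      ‖z₂‖ < ‖z₁‖ → (∀ i, ‖z₁ - z₂‖ + ‖zt i‖ < ‖z₂‖) →
      ∀ φ : W →ₗ[ℂ] ℂ, InGradedDual B.gr.proj φ →
        AbsConvTo (fun k : ℤ × ℤ =>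
            B.gr.pair φ (B.gr.ext (fun x => B.YL v₁ x k.1)
                (B.gr.ext (fun x => B.YL v₂ x k.2) (f zt)))
              * z₁ ^ (-k.1 - 1) * z₂ ^ (-k.2 - 1))
          (B.gr.pair φ (h (Fin.cons z₁ (Fin.cons z₂ zt)))) ∧
        AbsConvTo (fun k : ℤ × ℤ =>
            B.gr.pair φ (B.gr.ext (fun x => B.YL (A.Y v₁ v₂ k.2) x k.1) (f zt))
              * (z₁ - z₂) ^ (-k.2 - 1) * z₂ ^ (-k.1 - 1))
          (B.gr.pair φ (h (Fin.cons z₁ (Fin.cons z₂ zt))))) ∧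
    (∀ (z₁ z₂ : ℂ) (zt : Fin n → ℂ), Conf (Fin.cons z₁ (Fin.cons z₂ zt)) →
      (∀ i, ‖z₁ - z₂‖ + ‖zt i‖ < ‖z₂‖) →
      ∀ φ : W →ₗ[ℂ] ℂ, InGradedDual B.gr.proj φ →
        AbsConvTo (fun k : ℤ × ℤ =>
            B.gr.pair φ (B.gr.ext (fun x => B.YL (A.Y v₁ v₂ k.2) x k.1) (f zt))
              * (z₁ - z₂) ^ (-k.2 - 1) * z₂ ^ (-k.1 - 1))
          (B.gr.pair φ (h (Fin.cons z₁ (Fin.cons z₂ zt))))) := by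
  have main : ∀ (z₁ z₂ : ℂ) (zt : Fin n → ℂ), Conf (Fin.cons z₁ (Fin.cons z₂ zt)) →
      (∀ i, ‖z₁ - z₂‖ + ‖zt i‖ < ‖z₂‖) →
      ∀ φ : W →ₗ[ℂ] ℂ, InGradedDual B.gr.proj φ →
        AbsConvTo (fun k : ℤ × ℤ =>
            B.gr.pair φ (B.gr.ext (fun x => B.YL (A.Y v₁ v₂ k.2) x k.1) (f zt))
              * (z₁ - z₂) ^ (-k.2 - 1) * z₂ ^ (-k.1 - 1))
          (B.gr.pair φ (h (Fin.cons z₁ (Fin.cons z₂ zt)))) := by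
    intro z₁ z₂ zt hz hlt φ hφ
    obtain ⟨R, hR⟩ := hhW.1 φ hφ
    rw [absConvTo_iff, hR _ hz]
    refine B.hasSum_iterate v₁ v₂ hφ (f zt) hz.of_cons_cons.1 R (fun y₁ y₂ hy hy₂ hyt => ?_)
      hz.of_cons_cons.2 hlt
    rw [← hR _ hy]
    exact (hconv y₁ y₂ zt hy hy₂ hyt φ hφ).2
  refine ⟨fun z₁ z₂ zt hz h₂₁ hlt φ hφ => ⟨hconv z₁ z₂ zt hz h₂₁ (fun i => ?_) φ hφ,
    main z₁ z₂ zt hz hlt φ hφ⟩, main⟩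
  linarith [hlt i, norm_nonneg (z₁ - z₂)]

end VA
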